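/- Fix 0 < c < 1 and let G_n ∈ G(n, c/n). Let F_n be the distribution function of (β(G_n) − E[β(G_n)]) / sqrt(Var[β(G_n)]) and let Φ be the distribution function of the standard normal law. Then d(F_n, Φ) = O(n^{−1/2}), where d(F,Φ) = sup_h |∫ h dF − ∫ h dΦ| / (sup_x |h(x)| + sup_x |h′(x)|), the supremum being over all bounded differentiable test functions h with bounded derivative. -/

import Mathlib

open scoped Classical BigOperators
open Filter Topology

noncomputable section

namespace MetricDimPaper

/-- `R` is a resolving set of `G`: every pair of distinct vertices is distinguished by its
vector of (extended, possibly infinite) distances to the vertices of `R`. -/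
def Resolves {V : Type*} (G : SimpleGraph V) (R : Set V) : Prop :=
  ∀ u v : V, u ≠ v → ∃ w ∈ R, G.edist u w ≠ G.edist v w

/-- The metric dimension of a graph: the least cardinality of a resolving set, with the
convention that a single isolated vertex has metric dimension 1. -/
def metricDim {V : Type*} (G : SimpleGraph V) : ℕ :=
  if Nat.card V = 1 then 1
  else sInf {m : ℕ | ∃ R : Set V, R.ncard = m ∧ Resolves G R}

/-- A tree: a connected acyclic graph. -/
def IsTree {V : Type*} (G : SimpleGraph V) : Prop := G.Connected ∧ G.IsAcyclic

/-- degree of a vertex (as `Nat.card` of the neighbor set). -/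
def ndeg {V : Type*} (G : SimpleGraph V) (v : V) : ℕ := (G.neighborSet v).ncard

/-- metric dimension as a real number -/
def betaR {n : ℕ} (G : SimpleGraph (Fin n)) : ℝ := (metricDim G : ℝ)

def treeSet (n : ℕ) : Set (SimpleGraph (Fin n)) := {G | IsTree G}

def forestSet (n : ℕ) : Set (SimpleGraph (Fin n)) := {G | G.IsAcyclic}

/-- Expectation of `f` under the uniform distribution on the (finite) set `S` of graphs. -/
def unifExp {n : ℕ} (S : Set (SimpleGraph (Fin n))) (f : SimpleGraph (Fin n) → ℝ) : ℝ :=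
  (∑ᶠ G ∈ S, f G) / (Nat.card ↥S)

/-- Variance of `f` under the uniform distribution on `S`. -/
def unifVar {n : ℕ} (S : Set (SimpleGraph (Fin n))) (f : SimpleGraph (Fin n) → ℝ) : ℝ :=
  unifExp S (fun G => (f G - unifExp S f) ^ 2)

/-- Probability of the event `A` under the uniform distribution on `S`. -/
def unifPr {n : ℕ} (S A : Set (SimpleGraph (Fin n))) : ℝ :=
  (Nat.card ↥(S ∩ A) : ℝ) / (Nat.card ↥S)

/-- The probability weight of an individual graph in the Erdős–Rényi model `G(n,p)`. -/
def erWeight (n : ℕ) (p : ℝ) (G : SimpleGraph (Fin n)) : ℝ :=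
  p ^ (Nat.card ↥G.edgeSet) * (1 - p) ^ (n.choose 2 - Nat.card ↥G.edgeSet)

/-- Expectation of `f` in the Erdős–Rényi model `G(n,p)`. -/
def erExp (n : ℕ) (p : ℝ) (f : SimpleGraph (Fin n) → ℝ) : ℝ :=
  ∑ᶠ G : SimpleGraph (Fin n), erWeight n p G * f G

/-- Variance of `f` in the Erdős–Rényi model `G(n,p)`. -/
def erVar (n : ℕ) (p : ℝ) (f : SimpleGraph (Fin n) → ℝ) : ℝ :=
  erExp n p (fun G => (f G - erExp n p f) ^ 2)

/-- Probability of the event `A` in the Erdős–Rényi model `G(n,p)`. -/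
def erPr (n : ℕ) (p : ℝ) (A : Set (SimpleGraph (Fin n))) : ℝ :=
  ∑ᶠ G ∈ A, erWeight n p G

/-- The cumulative distribution function of the standard normal law. -/
def stdGaussianCDF (x : ℝ) : ℝ :=
  (Real.sqrt (2 * Real.pi))⁻¹ * ∫ t in Set.Iic x, Real.exp (-(t ^ 2) / 2)

/-- The normalized metric dimension `(β - E β)/sqrt (Var β)` for the uniform model on `S`. -/
def normβ {n : ℕ} (S : Set (SimpleGraph (Fin n))) (G : SimpleGraph (Fin n)) : ℝ :=
  (betaR G - unifExp S betaR) / Real.sqrt (unifVar S betaR)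

/-- The normalized metric dimension `(β - E β)/sqrt (Var β)` for the `G(n,p)` model. -/
def erNormβ (n : ℕ) (p : ℝ) (G : SimpleGraph (Fin n)) : ℝ :=
  (betaR G - erExp n p betaR) / Real.sqrt (erVar n p betaR)



section BernoulliProduct

variable {ι : Type*}

/-- The configuration `ω` with the coordinate `i` replaced by `b`. -/
def setBit (ω : ι → Bool) (i : ι) (b : Bool) : ι → Bool := Function.update ω i b

lemma setBit_self (ω : ι → Bool) (i : ι) (b : Bool) : setBit ω i b i = b := by
  simp [setBit]

lemma setBit_of_ne (ω : ι → Bool) {i j : ι} (h : j ≠ i) (b : Bool) : setBit ω i b j = ω j := by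
  simp [setBit, h]

lemma setBit_idem (ω : ι → Bool) (i : ι) (a b : Bool) :
    setBit (setBit ω i a) i b = setBit ω i b := by
  simp [setBit]

lemma setBit_comm (ω : ι → Bool) {i j : ι} (h : i ≠ j) (a b : Bool) :
    setBit (setBit ω i a) j b = setBit (setBit ω j b) i a := by
  unfold setBit; exact Function.update_comm h a b ω

variable [Fintype ι]

/-- The Bernoulli weight of a single bit. -/
def bitWeight (p : ℝ) (b : Bool) : ℝ := if b then p else 1 - p

/-- The product Bernoulli weight of a configuration. -/
def prodWeight (p : ℝ) (ω : ι → Bool) : ℝ := ∏ i, bitWeight p (ω i)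

/-- Expectation with respect to the product of Bernoulli(`p`) measures on `ι → Bool`. -/
def bernExp (p : ℝ) (f : (ι → Bool) → ℝ) : ℝ := ∑ ω, prodWeight p ω * f ω

/-- The configuration that agrees with `ω` on `A` and with `ω'` off `A`. -/
def splice (A : Set ι) (ω ω' : ι → Bool) : ι → Bool := fun i => if i ∈ A then ω i else ω' i

/-- The discrete derivative in the direction of the coordinate `i`. -/
def flipDiff (i : ι) (f : (ι → Bool) → ℝ) (ω : ι → Bool) : ℝ :=
  f (setBit ω i true) - f (setBit ω i false)

/-- The average over the coordinate `i`. -/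
def coordAvg (p : ℝ) (i : ι) (f : (ι → Bool) → ℝ) (ω : ι → Bool) : ℝ :=
  p * f (setBit ω i true) + (1 - p) * f (setBit ω i false)

/-- Variance with respect to the product of Bernoulli(`p`) measures. -/
def bernVar (p : ℝ) (f : (ι → Bool) → ℝ) : ℝ := bernExp p (fun ω => (f ω - bernExp p f) ^ 2)

variable {p : ℝ}

lemma bernExp_prod (p : ℝ) (F : ι → Bool → ℝ) :
    bernExp p (fun ω => ∏ i, F i (ω i)) = ∏ i, (p * F i true + (1 - p) * F i false) := by
  unfold bernExp prodWeight
  simp_rw [← Finset.prod_mul_distrib]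
  have := Finset.prod_univ_sum (fun _ : ι => (Finset.univ : Finset Bool))
    (fun i b => bitWeight p b * F i b)
  rw [Fintype.piFinset_univ] at this
  rw [← this]
  simp [bitWeight]

lemma bernExp_finset_prod (p : ℝ) (I : Finset ι) (F : Bool → ℝ) :
    bernExp p (fun ω => ∏ i ∈ I, F (ω i)) = (p * F true + (1 - p) * F false) ^ I.card := by
  have := bernExp_prod p (fun (i : ι) b => if i ∈ I then F b else 1)
  have h1 : ∀ ω : ι → Bool, ∏ i, (if i ∈ I then F (ω i) else 1) = ∏ i ∈ I, F (ω i) := by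
    intro ω; simp [Finset.prod_ite_mem]
  simp_rw [h1] at this
  rw [this]
  have h2 : ∀ i, (p * (if i ∈ I then F true else 1) + (1 - p) * (if i ∈ I then F false else 1))
      = if i ∈ I then (p * F true + (1 - p) * F false) else 1 := by
    intro i; split_ifs <;> ring
  simp_rw [h2]
  simp [Finset.prod_ite_mem]

lemma bernExp_const (p a : ℝ) : bernExp p (fun _ : ι → Bool => a) = a := by
  have := bernExp_prod p (fun (_ : ι) _ => (1 : ℝ))
  unfold bernExp at *
  rw [← Finset.sum_mul]
  simp at this
  simp [this]

lemma bernExp_add (p : ℝ) (f g : (ι → Bool) → ℝ) :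
    bernExp p (fun ω => f ω + g ω) = bernExp p f + bernExp p g := by
  simp [bernExp, mul_add, Finset.sum_add_distrib]

lemma bernExp_sub (p : ℝ) (f g : (ι → Bool) → ℝ) :
    bernExp p (fun ω => f ω - g ω) = bernExp p f - bernExp p g := by
  simp [bernExp, mul_sub, Finset.sum_sub_distrib]

lemma bernExp_mul_left (p a : ℝ) (f : (ι → Bool) → ℝ) :
    bernExp p (fun ω => a * f ω) = a * bernExp p f := by
  simp only [bernExp, Finset.mul_sum]
  exact Finset.sum_congr rfl fun _ _ => by ring

lemma bernExp_mul_right (p a : ℝ) (f : (ι → Bool) → ℝ) :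
    bernExp p (fun ω => f ω * a) = bernExp p f * a := by
  simp_rw [mul_comm _ a]; exact bernExp_mul_left p a f

lemma bernExp_sum (p : ℝ) {κ : Type*} (s : Finset κ) (f : κ → (ι → Bool) → ℝ) :
    bernExp p (fun ω => ∑ k ∈ s, f k ω) = ∑ k ∈ s, bernExp p (f k) := by
  simp only [bernExp, Finset.mul_sum]
  exact Finset.sum_comm

lemma bernExp_comm (p : ℝ) {κ : Type*} [Fintype κ] (f : (ι → Bool) → (κ → Bool) → ℝ) :
    bernExp p (fun ω => bernExp p (fun ω' => f ω ω')) =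
      bernExp p (fun ω' => bernExp p (fun ω => f ω ω')) := by
  simp only [bernExp, Finset.mul_sum]
  rw [Finset.sum_comm]
  exact Finset.sum_congr rfl fun _ _ => Finset.sum_congr rfl fun _ _ => by ring

lemma prodWeight_nonneg (hp0 : 0 ≤ p) (hp1 : p ≤ 1) (ω : ι → Bool) : 0 ≤ prodWeight p ω :=
  Finset.prod_nonneg fun i _ => by unfold bitWeight; split_ifs <;> linarith

lemma bernExp_mono (hp0 : 0 ≤ p) (hp1 : p ≤ 1) {f g : (ι → Bool) → ℝ} (h : ∀ ω, f ω ≤ g ω) :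
    bernExp p f ≤ bernExp p g :=
  Finset.sum_le_sum fun ω _ => mul_le_mul_of_nonneg_left (h ω) (prodWeight_nonneg hp0 hp1 ω)

lemma bernExp_nonneg (hp0 : 0 ≤ p) (hp1 : p ≤ 1) {f : (ι → Bool) → ℝ} (h : ∀ ω, 0 ≤ f ω) :
    0 ≤ bernExp p f :=
  Finset.sum_nonneg fun ω _ => mul_nonneg (prodWeight_nonneg hp0 hp1 ω) (h ω)

lemma abs_bernExp_le (hp0 : 0 ≤ p) (hp1 : p ≤ 1) (f : (ι → Bool) → ℝ) :
    |bernExp p f| ≤ bernExp p (fun ω => |f ω|) := by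
  unfold bernExp
  refine (Finset.abs_sum_le_sum_abs _ _).trans (le_of_eq (Finset.sum_congr rfl fun ω _ => ?_))
  rw [abs_mul, abs_of_nonneg (prodWeight_nonneg hp0 hp1 ω)]

lemma bernExp_mul_sq_le (hp0 : 0 ≤ p) (hp1 : p ≤ 1) (f g : (ι → Bool) → ℝ) :
    (bernExp p (fun ω => f ω * g ω)) ^ 2 ≤
      bernExp p (fun ω => f ω ^ 2) * bernExp p (fun ω => g ω ^ 2) := by
  unfold bernExp
  refine Finset.sum_sq_le_sum_mul_sum_of_sq_le_mul _
    (fun ω _ => mul_nonneg (prodWeight_nonneg hp0 hp1 ω) (sq_nonneg _))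
    (fun ω _ => mul_nonneg (prodWeight_nonneg hp0 hp1 ω) (sq_nonneg _)) fun ω _ => le_of_eq (by ring)

lemma bernExp_sq_le (hp0 : 0 ≤ p) (hp1 : p ≤ 1) (f : (ι → Bool) → ℝ) :
    (bernExp p f) ^ 2 ≤ bernExp p (fun ω => f ω ^ 2) := by
  have := bernExp_mul_sq_le hp0 hp1 f (fun _ => 1)
  simpa [bernExp_const] using this

lemma bernExp_abs_le_sqrt (hp0 : 0 ≤ p) (hp1 : p ≤ 1) (f : (ι → Bool) → ℝ) :
    bernExp p (fun ω => |f ω|) ≤ Real.sqrt (bernExp p (fun ω => f ω ^ 2)) := by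
  refine Real.le_sqrt_of_sq_le ((bernExp_sq_le hp0 hp1 _).trans (le_of_eq ?_))
  simp_rw [sq_abs]

/-- Exchanging the coordinates off `A` with those of an independent copy. -/
lemma bernExp_splice (p : ℝ) (A : Set ι) (F : (ι → Bool) → ℝ) :
    bernExp p (fun ω => bernExp p (fun ω' => F (splice A ω ω'))) = bernExp p F := by
  have hinv : ∀ x : (ι → Bool) × (ι → Bool),
      (splice A (splice A x.1 x.2) (splice A x.2 x.1),
        splice A (splice A x.2 x.1) (splice A x.1 x.2)) = x := by
    intro x
    ext i <;> simp only [splice] <;> split_ifs <;> rfl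
  let e : (ι → Bool) × (ι → Bool) ≃ (ι → Bool) × (ι → Bool) :=
    ⟨fun x => (splice A x.1 x.2, splice A x.2 x.1), fun x => (splice A x.1 x.2, splice A x.2 x.1),
      hinv, hinv⟩
  have hw : ∀ x : (ι → Bool) × (ι → Bool),
      prodWeight p x.1 * prodWeight p x.2 = prodWeight p (e x).1 * prodWeight p (e x).2 := by
    intro x
    simp only [prodWeight, ← Finset.prod_mul_distrib, e, Equiv.coe_fn_mk, splice]
    refine Finset.prod_congr rfl fun i _ => ?_
    split_ifs
    · rfl
    · ring
  have h1 : bernExp p (fun ω => bernExp p (fun ω' => F (splice A ω ω'))) =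
      ∑ x : (ι → Bool) × (ι → Bool), prodWeight p x.1 * prodWeight p x.2 * F (e x).1 := by
    simp only [bernExp, Finset.mul_sum, Fintype.sum_prod_type, mul_assoc]
    rfl
  have h2 : bernExp p F =
      ∑ x : (ι → Bool) × (ι → Bool), prodWeight p x.1 * prodWeight p x.2 * F x.1 := by
    have : bernExp p F = bernExp p (fun ω => bernExp p (fun _ : ι → Bool => F ω)) := by
      simp_rw [bernExp_const]
    rw [this]
    simp only [bernExp, Finset.mul_sum, Fintype.sum_prod_type, mul_assoc]
  rw [h1, h2, ← Equiv.sum_comp e (fun x => prodWeight p x.1 * prodWeight p x.2 * F x.1)]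
  exact Finset.sum_congr rfl fun x _ => by rw [hw x]

lemma bernExp_coord (p : ℝ) (i : ι) (φ : Bool → ℝ) :
    bernExp p (fun ω => φ (ω i)) = p * φ true + (1 - p) * φ false := by
  simpa using bernExp_finset_prod p {i} φ

lemma bernExp_coordAvg (p : ℝ) (i : ι) (f : (ι → Bool) → ℝ) :
    bernExp p (coordAvg p i f) = bernExp p f := by
  rw [← bernExp_splice p {i}ᶜ f]
  congr 1
  ext ω
  have : ∀ ω', splice {i}ᶜ ω ω' = setBit ω i (ω' i) := by
    intro ω'
    ext j
    by_cases h : j = i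
    · subst h; simp [splice, setBit_self]
    · simp [splice, h, setBit_of_ne]
  simp_rw [this]
  rw [bernExp_coord p i (fun b => f (setBit ω i b))]
  rfl

lemma bernVar_eq (p : ℝ) (f : (ι → Bool) → ℝ) :
    bernVar p f = bernExp p (fun ω => f ω ^ 2) - bernExp p f ^ 2 := by
  unfold bernVar
  have : ∀ ω, (f ω - bernExp p f) ^ 2 = f ω ^ 2 - (2 * bernExp p f) * f ω + bernExp p f ^ 2 :=
    fun ω => by ring
  simp_rw [this]
  rw [bernExp_add, bernExp_sub, bernExp_mul_left, bernExp_const]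
  ring

lemma bernVar_coordAvg (p : ℝ) (i : ι) (f : (ι → Bool) → ℝ) :
    bernVar p f = bernVar p (coordAvg p i f) +
      p * (1 - p) * bernExp p (fun ω => flipDiff i f ω ^ 2) := by
  rw [bernVar_eq, bernVar_eq, bernExp_coordAvg, ← bernExp_coordAvg p i (fun ω => f ω ^ 2),
    ← bernExp_mul_left]
  have : bernExp p (coordAvg p i fun ω => f ω ^ 2) = bernExp p (fun ω => coordAvg p i f ω ^ 2 +
      p * (1 - p) * flipDiff i f ω ^ 2) := by
    congr 1
    ext ω
    simp only [coordAvg, flipDiff]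
    ring
  rw [this, bernExp_add]
  ring

lemma bernExp_flipDiff_coordAvg_sq_le (hp0 : 0 ≤ p) (hp1 : p ≤ 1) (i j : ι)
    (f : (ι → Bool) → ℝ) :
    bernExp p (fun ω => flipDiff j (coordAvg p i f) ω ^ 2) ≤
      bernExp p (fun ω => flipDiff j f ω ^ 2) := by
  by_cases hij : i = j
  · subst hij
    have : ∀ ω, flipDiff i (coordAvg p i f) ω = 0 := by
      intro ω; simp [flipDiff, coordAvg, setBit_idem]
    simp_rw [this]
    simp only [ne_eq, OfNat.ofNat_ne_zero, not_false_eq_true, zero_pow, bernExp_const]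
    exact bernExp_nonneg hp0 hp1 fun ω => sq_nonneg _
  · rw [← bernExp_coordAvg p i (fun ω => flipDiff j f ω ^ 2)]
    refine bernExp_mono hp0 hp1 fun ω => ?_
    have : flipDiff j (coordAvg p i f) ω = coordAvg p i (flipDiff j f) ω := by
      simp only [flipDiff, coordAvg]
      simp_rw [setBit_comm _ (Ne.symm hij)]
      ring
    rw [this]
    simp only [coordAvg]
    nlinarith [mul_nonneg (mul_nonneg hp0 (sub_nonneg.2 hp1))
      (sq_nonneg (flipDiff j f (setBit ω i true) -
        flipDiff j f (setBit ω i false)))]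

/-- The Efron–Stein inequality for functions of independent Bernoulli variables. -/
lemma bernVar_le_sum_flipDiff (hp0 : 0 ≤ p) (hp1 : p ≤ 1) (f : (ι → Bool) → ℝ) :
    bernVar p f ≤ p * (1 - p) * ∑ i, bernExp p (fun ω => flipDiff i f ω ^ 2) := by
  suffices H : ∀ (S : Finset ι) (f : (ι → Bool) → ℝ),
      (∀ ω ω', (∀ i ∈ S, ω i = ω' i) → f ω = f ω') →
      bernVar p f ≤ p * (1 - p) * ∑ i ∈ S, bernExp p (fun ω => flipDiff i f ω ^ 2) from
    H Finset.univ f fun ω ω' h => congrArg f (funext fun i => h i (Finset.mem_univ i))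
  intro S
  induction S using Finset.induction_on with
  | empty =>
    intro f hf
    have : f = fun _ => f (fun _ => false) := funext fun ω => hf _ _ (by simp)
    rw [this]
    simp [bernVar, bernExp_const]
  | insert i S hi ih =>
    intro f hf
    rw [bernVar_coordAvg p i f, Finset.sum_insert hi]
    have h1 := ih (coordAvg p i f) (by
      intro ω ω' h
      have : ∀ b, f (setBit ω i b) = f (setBit ω' i b) := by
        intro b
        refine hf _ _ fun j hj => ?_
        by_cases hji : j = i
        · subst hji; simp [setBit_self]
        · simp [setBit_of_ne, hji, h j (Finset.mem_of_mem_insert_of_ne hj hji)]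
      simp [coordAvg, this])
    have h2 : ∑ j ∈ S, bernExp p (fun ω => flipDiff j (coordAvg p i f) ω ^ 2) ≤
        ∑ j ∈ S, bernExp p (fun ω => flipDiff j f ω ^ 2) :=
      Finset.sum_le_sum fun j _ => bernExp_flipDiff_coordAvg_sq_le hp0 hp1 i j f
    have h3 := mul_le_mul_of_nonneg_left h2 (mul_nonneg hp0 (sub_nonneg.2 hp1))
    linarith

lemma bernExp_bit_sub_mul (p : ℝ) (i : ι) (f : (ι → Bool) → ℝ) :
    bernExp p (fun ω => ((if ω i then 1 else 0) - p) * f ω) =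
      p * (1 - p) * bernExp p (flipDiff i f) := by
  rw [← bernExp_coordAvg p i, ← bernExp_mul_left]
  congr 1
  ext ω
  simp only [coordAvg, flipDiff, setBit_self]
  simp
  ring

/-- Lower bound of the variance by the projection on the sum of all coordinates. -/
lemma sq_sum_flipDiff_le_bernVar (hp0 : 0 ≤ p) (hp1 : p ≤ 1) (f : (ι → Bool) → ℝ) :
    (p * (1 - p) * ∑ i, bernExp p (flipDiff i f)) ^ 2 ≤
      bernVar p f * (p * Fintype.card ι) := by
  set Z : (ι → Bool) → ℝ := fun ω => ∑ i, ((if ω i then 1 else 0) - p) with hZ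
  have hEZ : bernExp p Z = 0 := by
    rw [hZ, bernExp_sum]
    refine Finset.sum_eq_zero fun i _ => ?_
    rw [bernExp_coord p i (fun b => (if b then (1 : ℝ) else 0) - p)]
    simp
    ring
  have hVZ : bernExp p (fun ω => Z ω ^ 2) ≤ p * Fintype.card ι := by
    have h1 := bernVar_le_sum_flipDiff hp0 hp1 Z
    rw [bernVar_eq, hEZ] at h1
    have h2 : ∀ i ω, flipDiff i Z ω = 1 := by
      intro i ω
      simp only [flipDiff, hZ, ← Finset.sum_sub_distrib]
      rw [Finset.sum_eq_single i]
      · simp [setBit_self]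
      · intro j _ hj; simp [setBit_of_ne, hj]
      · simp
    simp_rw [h2] at h1
    simp only [one_pow, bernExp_const, Finset.sum_const, Finset.card_univ, nsmul_eq_mul,
      mul_one] at h1
    have : (0 : ℝ) ≤ p * p * Fintype.card ι := by positivity
    nlinarith
  have hcov : bernExp p (fun ω => (f ω - bernExp p f) * Z ω) =
      p * (1 - p) * ∑ i, bernExp p (flipDiff i f) := by
    have : ∀ ω, (f ω - bernExp p f) * Z ω = (∑ i, ((if ω i then 1 else 0) - p) * f ω) -
        bernExp p f * Z ω := by
      intro ω; rw [← Finset.sum_mul, sub_mul, mul_comm]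
    simp_rw [this]
    rw [bernExp_sub, bernExp_mul_left, hEZ, bernExp_sum]
    simp_rw [bernExp_bit_sub_mul]
    rw [Finset.mul_sum]
    ring
  rw [← hcov]
  refine (bernExp_mul_sq_le hp0 hp1 _ _).trans ?_
  exact mul_le_mul_of_nonneg_left hVZ (bernExp_nonneg hp0 hp1 fun ω => sq_nonneg _)

end BernoulliProduct

section SteinEquation

/-- Integral of `h` against the standard normal law. -/
def gaussInt (h : ℝ → ℝ) : ℝ :=
  ∫ x : ℝ, h x * (Real.exp (-(x ^ 2) / 2) / Real.sqrt (2 * Real.pi))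

lemma hasDerivAt_exp_neg_sq (t : ℝ) :
    HasDerivAt (fun t : ℝ => Real.exp (-(t ^ 2) / 2)) (-t * Real.exp (-(t ^ 2) / 2)) t := by
  have h : HasDerivAt (fun t : ℝ => -(t ^ 2) / 2) (-t) t := by
    exact (((hasDerivAt_pow 2 t).neg).div_const 2).congr_deriv (by simp; ring)
  exact h.exp.congr_deriv (by ring)

lemma tendsto_exp_neg_sq_atTop :
    Tendsto (fun t : ℝ => Real.exp (-(t ^ 2) / 2)) atTop (𝓝 0) := by
  refine Real.tendsto_exp_atBot.comp ?_
  have : Tendsto (fun t : ℝ => t ^ 2 / 2) atTop atTop :=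
    (tendsto_pow_atTop (two_ne_zero)).atTop_div_const (by norm_num)
  have := tendsto_neg_atTop_atBot.comp this
  refine this.congr fun t => ?_
  simp
  ring

lemma le_gaussian_tail {u u' : ℝ → ℝ} {B x : ℝ} (hB : 0 ≤ B) (hx : 0 < x)
    (hu : ∀ t, HasDerivAt u (u' t) t)
    (hu' : ∀ t, -(B * Real.exp (-(t ^ 2) / 2)) ≤ u' t) (hlim : Tendsto u atTop (𝓝 0)) :
    u x ≤ B / x * Real.exp (-(x ^ 2) / 2) := by
  set w : ℝ → ℝ := fun t => u t - B / x * Real.exp (-(t ^ 2) / 2) with hw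
  have hd : ∀ t, HasDerivAt w (u' t - B / x * (-t * Real.exp (-(t ^ 2) / 2))) t := fun t =>
    (hu t).sub ((hasDerivAt_exp_neg_sq t).const_mul _)
  have hmono : MonotoneOn w (Set.Ici x) := by
    refine monotoneOn_of_deriv_nonneg (convex_Ici x)
      (fun t _ => (hd t).continuousAt.continuousWithinAt)
      (fun t _ => (hd t).differentiableAt.differentiableWithinAt) fun t ht => ?_
    rw [interior_Ici] at ht
    rw [(hd t).deriv]
    have h1 : 1 ≤ t / x := (one_le_div hx).2 (le_of_lt ht)
    have h2 : 0 ≤ B * Real.exp (-(t ^ 2) / 2) := by positivity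
    have h3 := hu' t
    have h4 : B / x * (-t * Real.exp (-(t ^ 2) / 2)) =
      -(t / x) * (B * Real.exp (-(t ^ 2) / 2)) := by ring
    rw [h4]
    nlinarith
  have hwlim : Tendsto w atTop (𝓝 0) := by
    have := hlim.sub (tendsto_exp_neg_sq_atTop.const_mul (B / x))
    simpa using this
  have : w x ≤ 0 := by
    refine ge_of_tendsto hwlim ?_
    filter_upwards [eventually_ge_atTop x] with t ht
    exact hmono (Set.self_mem_Ici) ht ht
  simp only [hw] at this
  linarith

/-- A function whose derivative is dominated by the Gaussian density and which vanishes at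
both ends has Gaussian tails. -/
lemma abs_mul_le_of_gaussian_deriv {f F : ℝ → ℝ} {B : ℝ} (hB : 0 ≤ B)
    (hf : ∀ t, HasDerivAt (fun t => Real.exp (-(t ^ 2) / 2) * f t)
      (Real.exp (-(t ^ 2) / 2) * F t) t)
    (hF : ∀ t, |F t| ≤ B)
    (htop : Tendsto (fun t => Real.exp (-(t ^ 2) / 2) * f t) atTop (𝓝 0))
    (hbot : Tendsto (fun t => Real.exp (-(t ^ 2) / 2) * f t) atBot (𝓝 0)) (x : ℝ) :
    |x * f x| ≤ B := by
  have key : ∀ (f F : ℝ → ℝ), (∀ t, HasDerivAt (fun t => Real.exp (-(t ^ 2) / 2) * f t)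
      (Real.exp (-(t ^ 2) / 2) * F t) t) → (∀ t, |F t| ≤ B) →
      Tendsto (fun t => Real.exp (-(t ^ 2) / 2) * f t) atTop (𝓝 0) → ∀ x, 0 < x →
      x * f x ≤ B := by
    intro f F hf hF htop x hx
    have := le_gaussian_tail hB hx hf (fun t => by
      have := (abs_le.1 (hF t)).1
      have he := Real.exp_pos (-(t ^ 2) / 2)
      nlinarith) htop
    have he := Real.exp_pos (-(x ^ 2) / 2)
    have h2 : f x ≤ B / x := by
      rw [mul_comm (B / x)] at this
      exact le_of_mul_le_mul_left this he
    calc x * f x ≤ x * (B / x) := mul_le_mul_of_nonneg_left h2 hx.le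
      _ = B := by field_simp
  have hneg : ∀ (f F : ℝ → ℝ), (∀ t, HasDerivAt (fun t => Real.exp (-(t ^ 2) / 2) * f t)
      (Real.exp (-(t ^ 2) / 2) * F t) t) → ∀ t, HasDerivAt
      (fun t => Real.exp (-(t ^ 2) / 2) * (-f t)) (Real.exp (-(t ^ 2) / 2) * (-F t)) t := by
    intro f F hf t
    have := (hf t).neg
    simp only [mul_neg]
    exact this
  have key2 : ∀ (f F : ℝ → ℝ), (∀ t, HasDerivAt (fun t => Real.exp (-(t ^ 2) / 2) * f t)
      (Real.exp (-(t ^ 2) / 2) * F t) t) → (∀ t, |F t| ≤ B) →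
      Tendsto (fun t => Real.exp (-(t ^ 2) / 2) * f t) atTop (𝓝 0) → ∀ x, 0 < x →
      |x * f x| ≤ B := by
    intro f F hf hF htop x hx
    refine abs_le.2 ⟨?_, key f F hf hF htop x hx⟩
    have := key (fun t => -f t) (fun t => -F t) (hneg f F hf) (by simpa using hF)
      (by simpa using htop.neg) x hx
    simp only [mul_neg] at this
    linarith
  rcases lt_trichotomy x 0 with hx | hx | hx
  · have := key2 (fun t => f (-t)) (fun t => -F (-t)) (fun t => by
      have := (hf (-t)).comp t (hasDerivAt_neg t)
      simp only [Function.comp_def, even_two, Even.neg_pow] at this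
      exact this.congr_deriv (by ring)) (fun t => by simpa using hF (-t)) (by
      have := hbot.comp tendsto_neg_atTop_atBot
      simpa [Function.comp_def] using this) (-x) (by linarith)
    simpa using this
  · subst hx; simpa using hB
  · exact key2 f F hf hF htop x hx

lemma integrable_gaussian_density :
    MeasureTheory.Integrable (fun x : ℝ => Real.exp (-(x ^ 2) / 2)) := by
  have := integrable_exp_neg_mul_sq (b := 1 / 2) (by norm_num)
  refine this.congr (Filter.Eventually.of_forall fun x => ?_)
  simp only
  congr 1
  ring

lemma integral_gaussian_density : ∫ x : ℝ, Real.exp (-(x ^ 2) / 2) = Real.sqrt (2 * Real.pi) := by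
  have := integral_gaussian (1 / 2)
  rw [show Real.pi / (1 / 2) = 2 * Real.pi by ring] at this
  rw [← this]
  congr 1
  ext x
  congr 1
  ring

lemma integrable_bdd_mul_gaussian {h : ℝ → ℝ} (hc : Continuous h) {H : ℝ} (hH : ∀ x, |h x| ≤ H) :
    MeasureTheory.Integrable (fun x : ℝ => h x * Real.exp (-(x ^ 2) / 2)) :=
  integrable_gaussian_density.bdd_mul hc.aestronglyMeasurable
    (Filter.Eventually.of_forall fun x => by simpa using hH x)

lemma gaussInt_eq (h : ℝ → ℝ) :
    gaussInt h * Real.sqrt (2 * Real.pi) = ∫ x : ℝ, h x * Real.exp (-(x ^ 2) / 2) := by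
  unfold gaussInt
  rw [← MeasureTheory.integral_mul_const]
  have : Real.sqrt (2 * Real.pi) ≠ 0 := by positivity
  congr 1
  ext x
  field_simp

lemma abs_gaussInt_le {h : ℝ → ℝ} (hc : Continuous h) {H : ℝ} (hH : ∀ x, |h x| ≤ H) :
    |gaussInt h| ≤ H := by
  have hs : 0 < Real.sqrt (2 * Real.pi) := by positivity
  refine le_of_mul_le_mul_right ?_ hs
  rw [← abs_of_pos hs, ← abs_mul, abs_of_pos hs, gaussInt_eq]
  calc |∫ x : ℝ, h x * Real.exp (-(x ^ 2) / 2)|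
      ≤ ∫ x : ℝ, |h x * Real.exp (-(x ^ 2) / 2)| := MeasureTheory.abs_integral_le_integral_abs
    _ ≤ ∫ x : ℝ, H * Real.exp (-(x ^ 2) / 2) := by
        refine MeasureTheory.integral_mono (integrable_bdd_mul_gaussian hc hH).abs
          (integrable_gaussian_density.const_mul H) fun x => ?_
        simp only [abs_mul, Real.abs_exp]
        exact mul_le_mul_of_nonneg_right (hH x) (Real.exp_pos _).le
    _ = H * Real.sqrt (2 * Real.pi) := by
        rw [MeasureTheory.integral_const_mul, integral_gaussian_density]

/-- Existence of the (integral) solution of the Stein equation, multiplied by the density. -/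
lemma exists_gaussian_antideriv {k : ℝ → ℝ} (hc : Continuous k)
    (hint : MeasureTheory.Integrable k) (h0 : ∫ x, k x = 0) :
    ∃ u : ℝ → ℝ, (∀ t, HasDerivAt u (k t) t) ∧ Tendsto u atTop (𝓝 0) ∧
      Tendsto u atBot (𝓝 0) := by
  refine ⟨fun x => (∫ t in Set.Iic 0, k t) + ∫ t in (0 : ℝ)..x, k t, fun t => ?_, ?_, ?_⟩
  · exact (intervalIntegral.integral_hasDerivAt_right (hc.intervalIntegrable _ _)
      (hc.stronglyMeasurableAtFilter _ _) hc.continuousAt).const_add _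
  · have h1 := MeasureTheory.intervalIntegral_tendsto_integral_Ioi (0 : ℝ) (hint.integrableOn)
      tendsto_id
    have h2 := h1.const_add (∫ t in Set.Iic 0, k t)
    rw [intervalIntegral.integral_Iic_add_Ioi hint.integrableOn hint.integrableOn, h0] at h2
    exact h2
  · have h1 := MeasureTheory.intervalIntegral_tendsto_integral_Iic (0 : ℝ) (hint.integrableOn)
      tendsto_id
    have h2 := (h1.const_sub (∫ t in Set.Iic 0, k t))
    rw [sub_self] at h2
    refine h2.congr fun x => ?_
    rw [intervalIntegral.integral_symm x 0]
    simp [sub_eq_add_neg]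

/-- Solution of Stein's equation, with bounds on the derivative and its Lipschitz constant. -/
lemma exists_stein_solution {h : ℝ → ℝ} (hd : Differentiable ℝ h) {H H' : ℝ}
    (hH : ∀ x, |h x| ≤ H) (hH' : ∀ x, |deriv h x| ≤ H') :
    ∃ f g : ℝ → ℝ, (∀ x, HasDerivAt f (g x) x) ∧ (∀ x, g x - x * f x = h x - gaussInt h) ∧
      (∀ x, |g x| ≤ 4 * H) ∧ ∀ x y, |g x - g y| ≤ (20 * H + 2 * H') * |x - y| := by
  have hc := hd.continuous
  set k : ℝ → ℝ := fun x => h x - gaussInt h with hk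
  have hH0 : 0 ≤ H := (abs_nonneg _).trans (hH 0)
  have hkb : ∀ x, |k x| ≤ 2 * H := fun x => by
    have h1 := abs_le.1 (hH x)
    have h2 := abs_le.1 (abs_gaussInt_le hc hH)
    exact abs_le.2 ⟨by simp only [hk]; linarith, by simp only [hk]; linarith⟩
  have hkc : Continuous k := hc.sub continuous_const
  have hec : Continuous fun x : ℝ => Real.exp (-(x ^ 2) / 2) := by fun_prop
  obtain ⟨u, hu, hutop, hubot⟩ := exists_gaussian_antideriv (hkc.mul hec)
    (integrable_bdd_mul_gaussian hkc hkb) (by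
      simp only [hk, Pi.mul_apply, sub_mul]
      rw [MeasureTheory.integral_sub (integrable_bdd_mul_gaussian hc hH)
        (integrable_gaussian_density.const_mul _), ← gaussInt_eq,
        MeasureTheory.integral_const_mul, integral_gaussian_density, sub_self])
  set f : ℝ → ℝ := fun x => u x * (Real.exp (-(x ^ 2) / 2))⁻¹ with hf
  have hfu : ∀ x, Real.exp (-(x ^ 2) / 2) * f x = u x := fun x => by
    have := (Real.exp_pos (-(x ^ 2) / 2)).ne'
    simp only [hf]
    field_simp
  set g : ℝ → ℝ := fun x => k x + x * f x with hg
  have hfd : ∀ x, HasDerivAt f (g x) x := fun x => by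
    have he := (Real.exp_pos (-(x ^ 2) / 2)).ne'
    refine ((hu x).mul ((hasDerivAt_exp_neg_sq x).inv he)).congr_deriv ?_
    simp only [hg, hf, Pi.inv_apply, Pi.mul_apply]
    field_simp
  have hfu' : (fun t => Real.exp (-(t ^ 2) / 2) * f t) = u := funext hfu
  have hxf : ∀ x, |x * f x| ≤ 2 * H := fun x => by
    refine abs_mul_le_of_gaussian_deriv (F := k) (by linarith) (fun t => ?_) hkb ?_ ?_ x
    · rw [hfu', mul_comm]; exact hu t
    · rw [hfu']; exact hutop
    · rw [hfu']; exact hubot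
  have hgb : ∀ x, |g x| ≤ 4 * H := fun x => by
    refine (abs_add_le _ _).trans ?_
    linarith [hkb x, hxf x]
  have hf1 : |f 1| ≤ 2 * H := by simpa using hxf 1
  have hfb : ∀ x, |f x| ≤ 10 * H := fun x => by
    by_cases hx : 1 ≤ |x|
    · have := hxf x
      rw [abs_mul] at this
      nlinarith [abs_nonneg (f x)]
    · push Not at hx
      have h1 := Convex.norm_image_sub_le_of_norm_hasDerivWithin_le (f := f) (f' := g)
        (C := 4 * H) (s := Set.univ) (fun y _ => (hfd y).hasDerivWithinAt)
        (fun y _ => by simpa using hgb y) convex_univ (Set.mem_univ 1) (Set.mem_univ x)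
      simp only [Real.norm_eq_abs] at h1
      have h2 : |x - 1| ≤ 2 := by
        have := abs_lt.1 hx
        exact abs_le.2 ⟨by linarith, by linarith⟩
      have h3 : |f x| ≤ |f x - f 1| + |f 1| := by
        have := abs_add_le (f x - f 1) (f 1); simpa using this
      nlinarith [abs_nonneg (x - 1)]
  have hH'0 : 0 ≤ H' := (abs_nonneg _).trans (hH' 0)
  have hgd : ∀ x, HasDerivAt g (deriv h x + (f x + x * g x)) x := fun x => by
    have h1 : HasDerivAt k (deriv h x) x := (hd x).hasDerivAt.sub_const _
    have h2 := h1.add ((hasDerivAt_id x).mul (hfd x))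
    exact h2.congr_deriv (by simp)
  have hegd : ∀ t, HasDerivAt (fun t => Real.exp (-(t ^ 2) / 2) * g t)
      (Real.exp (-(t ^ 2) / 2) * (deriv h t + f t)) t := fun t => by
    exact ((hasDerivAt_exp_neg_sq t).mul (hgd t)).congr_deriv (by ring)
  have hbd : ∀ t, |deriv h t + f t| ≤ H' + 10 * H := fun t =>
    (abs_add_le _ _).trans (add_le_add (hH' t) (hfb t))
  have htop : Tendsto (fun t => Real.exp (-(t ^ 2) / 2) * g t) atTop (𝓝 0) := by
    refine squeeze_zero_norm (fun t => ?_) (by simpa using tendsto_exp_neg_sq_atTop.mul_const (4 * H))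
    rw [norm_mul]
    simp only [Real.norm_eq_abs, Real.abs_exp]
    exact mul_le_mul_of_nonneg_left (hgb t) (Real.exp_pos _).le
  have hbot : Tendsto (fun t => Real.exp (-(t ^ 2) / 2) * g t) atBot (𝓝 0) := by
    have h1 : Tendsto (fun t : ℝ => Real.exp (-(t ^ 2) / 2)) atBot (𝓝 0) := by
      have := tendsto_exp_neg_sq_atTop.comp tendsto_neg_atBot_atTop
      simpa [Function.comp_def] using this
    refine squeeze_zero_norm (fun t => ?_) (by simpa using h1.mul_const (4 * H))
    rw [norm_mul]
    simp only [Real.norm_eq_abs, Real.abs_exp]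
    exact mul_le_mul_of_nonneg_left (hgb t) (Real.exp_pos _).le
  have hxg : ∀ x, |x * g x| ≤ H' + 10 * H := fun x =>
    abs_mul_le_of_gaussian_deriv (by linarith) hegd hbd htop hbot x
  refine ⟨f, g, hfd, fun x => by simp [hg, hk], hgb, fun x y => ?_⟩
  have h1 := Convex.norm_image_sub_le_of_norm_hasDerivWithin_le (f := g)
    (C := 20 * H + 2 * H') (s := Set.univ) (fun y _ => (hgd y).hasDerivWithinAt)
    (fun t _ => by
      rw [← add_assoc]
      refine (norm_add_le _ _).trans ?_
      simp only [Real.norm_eq_abs]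
      linarith [hbd t, hxg t]) convex_univ (Set.mem_univ y) (Set.mem_univ x)
  simpa using h1

lemma abs_taylor_le {f g : ℝ → ℝ} (hf : ∀ x, HasDerivAt f (g x) x) {L : ℝ} (hL0 : 0 ≤ L)
    (hL : ∀ x y, |g x - g y| ≤ L * |x - y|) (x d : ℝ) :
    |f (x + d) - f x - d * g x| ≤ L * d ^ 2 := by
  have h1 := Convex.norm_image_sub_le_of_norm_hasDerivWithin_le
    (f := fun t => f t - t * g x) (f' := fun t => g t - 1 * g x)
    (C := L * |d|) (s := Set.uIcc x (x + d))
    (fun y _ => ((hf y).sub ((hasDerivAt_id y).mul_const (g x))).hasDerivWithinAt)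
    (fun y hy => by
      rw [one_mul, Real.norm_eq_abs]
      refine (hL y x).trans (mul_le_mul_of_nonneg_left ?_ hL0)
      have := Set.abs_sub_left_of_mem_uIcc hy
      simpa using this) (convex_uIcc x (x + d)) (Set.left_mem_uIcc) (Set.right_mem_uIcc)
  simp only [Real.norm_eq_abs, add_sub_cancel_left] at h1
  rw [mul_assoc, ← abs_mul, ← pow_two, abs_of_nonneg (sq_nonneg d)] at h1
  convert h1 using 2
  ring

end SteinEquation

section AbstractStein

variable {ι κ : Type*} [Fintype ι] [Fintype κ] {p : ℝ}

/-- Covariance identity for a sum of local terms that can be coupled with an independent copy. -/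
lemma bernExp_centered_mul (Y : (ι → Bool) → ℝ) (ξ : κ → (ι → Bool) → ℝ)
    (D : κ → (ι → Bool) → (ι → Bool) → ℝ) (hsum : ∀ ω, ∑ v, ξ v ω = Y ω)
    (hid : ∀ v (φ : ℝ → ℝ), bernExp p (fun ω => ξ v ω * φ (Y ω)) =
      bernExp p (fun ω' => bernExp p (fun ω => ξ v ω * φ (Y ω' + D v ω ω')))) (φ : ℝ → ℝ) :
    bernExp p (fun ω => (Y ω - bernExp p Y) * φ (Y ω)) =
      bernExp p (fun ω' => ∑ v, bernExp p (fun ω =>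
        ξ v ω * (φ (Y ω' + D v ω ω') - φ (Y ω')))) := by
  rw [bernExp_sum]
  have h1 : ∀ v, bernExp p (fun ω' => bernExp p (fun ω =>
        ξ v ω * (φ (Y ω' + D v ω ω') - φ (Y ω')))) =
      bernExp p (fun ω => ξ v ω * φ (Y ω)) -
        bernExp p (ξ v) * bernExp p (fun ω => φ (Y ω)) := by
    intro v
    simp_rw [mul_sub, bernExp_sub, bernExp_mul_right, bernExp_mul_left]
    rw [← hid]
  simp_rw [h1]
  rw [Finset.sum_sub_distrib, ← Finset.sum_mul, ← bernExp_sum, ← bernExp_sum]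
  simp_rw [← Finset.sum_mul, hsum, sub_mul]
  rw [bernExp_sub, bernExp_mul_left]

/-- Stein's method for a sum of local terms that can be coupled with an independent copy. -/
lemma abs_bernExp_sub_gaussInt_le (hp0 : 0 ≤ p) (hp1 : p ≤ 1) (Y : (ι → Bool) → ℝ)
    (ξ : κ → (ι → Bool) → ℝ)
    (D : κ → (ι → Bool) → (ι → Bool) → ℝ) (hsum : ∀ ω, ∑ v, ξ v ω = Y ω)
    (hid : ∀ v (φ : ℝ → ℝ), bernExp p (fun ω => ξ v ω * φ (Y ω)) =
      bernExp p (fun ω' => bernExp p (fun ω => ξ v ω * φ (Y ω' + D v ω ω'))))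
    (hξ : ∀ v ω, |ξ v ω| ≤ 1) {B B' σ : ℝ}
    (hD : ∀ v, bernExp p (fun ω' => bernExp p (fun ω => D v ω ω' ^ 2)) ≤ B)
    (hT : bernVar p (fun ω' => ∑ v, bernExp p (fun ω => ξ v ω * D v ω ω')) ≤ B')
    (hσ : 0 < σ) (hvar : σ ^ 2 = bernVar p Y)
    {h : ℝ → ℝ} (hd : Differentiable ℝ h) {H H' : ℝ}
    (hH : ∀ x, |h x| ≤ H) (hH' : ∀ x, |deriv h x| ≤ H') :
    |bernExp p (fun ω => h ((Y ω - bernExp p Y) / σ)) - gaussInt h| ≤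
      4 * H * Real.sqrt B' / σ ^ 2 + (20 * H + 2 * H') * (Fintype.card κ * B) / σ ^ 3 := by
  obtain ⟨f, g, hfd, hfg, hgb, hgL⟩ := exists_stein_solution hd hH hH'
  have hH0 : 0 ≤ H := (abs_nonneg _).trans (hH 0)
  have hH'0 : 0 ≤ H' := (abs_nonneg _).trans (hH' 0)
  set L := 20 * H + 2 * H' with hL
  have hL0 : 0 ≤ L := by positivity
  set μ := bernExp p Y with hμ
  set T : (ι → Bool) → ℝ := fun ω' => ∑ v, bernExp p (fun ω => ξ v ω * D v ω ω') with hTdef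
  set W : (ι → Bool) → ℝ := fun ω => (Y ω - μ) / σ with hW
  have hET : bernExp p T = σ ^ 2 := by
    have := bernExp_centered_mul Y ξ D hsum hid (fun y => y - μ)
    rw [hvar, bernVar]
    simp only [← hμ, pow_two] at this ⊢
    rw [this]
    simp [hTdef]
  have hstein := bernExp_centered_mul Y ξ D hsum hid (fun y => f ((y - μ) / σ))
  have hWf : bernExp p (fun ω => W ω * f (W ω)) = σ⁻¹ * bernExp p (fun ω' => ∑ v,
      bernExp p (fun ω => ξ v ω * (f (W ω' + D v ω ω' / σ) - f (W ω')))) := by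
    have : ∀ ω' v ω, f (W ω' + D v ω ω' / σ) = f ((Y ω' + D v ω ω' - μ) / σ) := by
      intro ω' v ω
      simp only [hW]
      congr 1
      ring
    simp_rw [this]
    rw [← hstein, ← bernExp_mul_left]
    congr 1
    ext ω
    simp only [hW]
    ring
  have hLHS : bernExp p (fun ω => h (W ω)) - gaussInt h =
      bernExp p (fun ω => g (W ω)) - bernExp p (fun ω => W ω * f (W ω)) := by
    rw [← bernExp_sub]
    simp_rw [hfg]
    rw [bernExp_sub, bernExp_const]
  set R : κ → (ι → Bool) → (ι → Bool) → ℝ := fun v ω ω' =>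
    f (W ω' + D v ω ω' / σ) - f (W ω') - D v ω ω' / σ * g (W ω') with hR
  have hRb : ∀ v ω ω', |R v ω ω'| ≤ L / σ ^ 2 * D v ω ω' ^ 2 := by
    intro v ω ω'
    refine (abs_taylor_le hfd hL0 hgL _ _).trans (le_of_eq ?_)
    rw [div_pow]
    ring
  have hdecomp : bernExp p (fun ω' => ∑ v,
      bernExp p (fun ω => ξ v ω * (f (W ω' + D v ω ω' / σ) - f (W ω')))) =
      σ⁻¹ * bernExp p (fun ω' => T ω' * g (W ω')) +
      ∑ v, bernExp p (fun ω' => bernExp p (fun ω => ξ v ω * R v ω ω')) := by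
    rw [← bernExp_sum, ← bernExp_mul_left, ← bernExp_add]
    congr 1
    ext ω'
    rw [hTdef, Finset.sum_mul, Finset.mul_sum, ← Finset.sum_add_distrib]
    refine Finset.sum_congr rfl fun v _ => ?_
    rw [← bernExp_mul_right, ← bernExp_mul_left, ← bernExp_add]
    congr 1
    ext ω
    simp only [hR]
    ring
  have hrest : |∑ v, bernExp p (fun ω' => bernExp p (fun ω => ξ v ω * R v ω ω'))| ≤
      Fintype.card κ * (L / σ ^ 2 * B) := by
    refine (Finset.abs_sum_le_sum_abs _ _).trans ?_
    have : ∀ v ∈ Finset.univ, |bernExp p (fun ω' => bernExp p (fun ω => ξ v ω * R v ω ω'))| ≤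
        L / σ ^ 2 * B := by
      intro v _
      refine (abs_bernExp_le hp0 hp1 _).trans ?_
      refine le_trans (bernExp_mono hp0 hp1 (g := fun ω' => L / σ ^ 2 *
        bernExp p (fun ω => D v ω ω' ^ 2)) fun ω' => ?_) ?_
      · refine (abs_bernExp_le hp0 hp1 _).trans ?_
        rw [← bernExp_mul_left]
        refine bernExp_mono hp0 hp1 fun ω => ?_
        rw [abs_mul]
        exact (mul_le_of_le_one_left (abs_nonneg _) (hξ v ω)).trans (hRb v ω ω')
      · rw [bernExp_mul_left]
        exact mul_le_mul_of_nonneg_left (hD v) (by positivity)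
    refine (Finset.sum_le_sum this).trans (le_of_eq ?_)
    simp
  have hmain : |bernExp p (fun ω => (T ω - bernExp p T) * g (W ω))| ≤ 4 * H * Real.sqrt B' := by
    refine (abs_bernExp_le hp0 hp1 _).trans ?_
    calc bernExp p (fun ω => |(T ω - bernExp p T) * g (W ω)|)
        ≤ bernExp p (fun ω => 4 * H * |T ω - bernExp p T|) := by
          refine bernExp_mono hp0 hp1 fun ω => ?_
          rw [abs_mul, mul_comm]
          exact mul_le_mul_of_nonneg_right (hgb _) (abs_nonneg _)
      _ ≤ 4 * H * Real.sqrt B' := by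
          rw [bernExp_mul_left]
          refine mul_le_mul_of_nonneg_left ?_ (by positivity)
          exact (bernExp_abs_le_sqrt hp0 hp1 _).trans (Real.sqrt_le_sqrt hT)
  have hTg : bernExp p (fun ω => g (W ω)) - (σ ^ 2)⁻¹ * bernExp p (fun ω => T ω * g (W ω)) =
      -((σ ^ 2)⁻¹ * bernExp p (fun ω => (T ω - bernExp p T) * g (W ω))) := by
    simp_rw [sub_mul]
    rw [bernExp_sub, bernExp_mul_left, hET]
    field_simp
    ring
  have hfinal : bernExp p (fun ω => h (W ω)) - gaussInt h =
      -((σ ^ 2)⁻¹ * bernExp p (fun ω => (T ω - bernExp p T) * g (W ω))) -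
      σ⁻¹ * ∑ v, bernExp p (fun ω' => bernExp p (fun ω => ξ v ω * R v ω ω')) := by
    rw [hLHS, hWf, hdecomp, ← hTg]
    field_simp
    ring
  rw [hfinal]
  refine (abs_sub _ _).trans ?_
  rw [abs_neg, abs_mul, abs_mul, abs_of_pos (inv_pos.2 hσ),
      abs_of_pos (by positivity : 0 < (σ ^ 2)⁻¹)]
  refine add_le_add ?_ ?_
  · rw [div_eq_inv_mul]
    exact mul_le_mul_of_nonneg_left hmain (by positivity)
  · refine (mul_le_mul_of_nonneg_left hrest (by positivity)).trans (le_of_eq ?_)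
    field_simp

end AbstractStein

section Clusters

variable {V : Type*}

/-- The spanning subgraph of `G` consisting of the edges inside `A`. -/
def keep (G : SimpleGraph V) (A : Finset V) : SimpleGraph V where
  Adj u v := G.Adj u v ∧ u ∈ A ∧ v ∈ A
  symm := ⟨fun _ _ h => ⟨h.1.symm, h.2.2, h.2.1⟩⟩
  loopless := ⟨fun _ h => h.1.ne rfl⟩

/-- No edge of `G` leaves `A`. -/
def Separated (G : SimpleGraph V) (A : Finset V) : Prop := ∀ u ∈ A, ∀ v, G.Adj u v → v ∈ A

lemma Separated.keep {G : SimpleGraph V} {A : Finset V} (h : Separated G A) (B : Finset V) :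
    Separated (keep G B) A := fun u hu v huv => h u hu v huv.1

lemma reachable_induction {G : SimpleGraph V} {P : V → Prop} {u x : V} (hu : P u)
    (hstep : ∀ x y, P x → G.Adj x y → P y) (h : G.Reachable u x) : P x := by
  obtain ⟨w⟩ := h
  induction w with
  | nil => exact hu
  | cons hadj _ ih => exact ih (hstep _ _ hu hadj)

lemma Separated.mem_of_reachable {G : SimpleGraph V} {A : Finset V} (h : Separated G A) {u x : V}
    (hu : u ∈ A) (hx : G.Reachable u x) : x ∈ A :=
  reachable_induction (P := (· ∈ A)) hu (fun x y hx hxy => h x hx y hxy) hx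

lemma keep_keep (G : SimpleGraph V) (A B : Finset V) : keep (keep G A) B = keep G (A ∩ B) := by
  ext u v
  simp only [keep, Finset.mem_inter]
  tauto

/-- The graph whose edges are the pairs selected by `ω`. -/
def cfgGraph (ω : Sym2 V → Bool) : SimpleGraph V := SimpleGraph.fromEdgeSet {e | ω e = true}

lemma cfgGraph_adj {ω : Sym2 V → Bool} {u v : V} :
    (cfgGraph ω).Adj u v ↔ ω s(u, v) = true ∧ u ≠ v := by
  simp [cfgGraph]

lemma keep_cfgGraph_congr {ω η : Sym2 V → Bool} {S : Finset V}
    (h : ∀ u ∈ S, ∀ v ∈ S, η s(u, v) = ω s(u, v)) :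
    keep (cfgGraph η) S = keep (cfgGraph ω) S := by
  ext u v
  simp only [keep, cfgGraph_adj]
  constructor
  · rintro ⟨⟨h1, h2⟩, hu, hv⟩; exact ⟨⟨h u hu v hv ▸ h1, h2⟩, hu, hv⟩
  · rintro ⟨⟨h1, h2⟩, hu, hv⟩; exact ⟨⟨(h u hu v hv).symm ▸ h1, h2⟩, hu, hv⟩

lemma cfgGraph_setBit_false_le (ω : Sym2 V → Bool) (e : Sym2 V) :
    cfgGraph (setBit ω e false) ≤ cfgGraph ω := by
  intro u v huv
  rw [cfgGraph_adj] at huv ⊢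
  refine ⟨?_, huv.2⟩
  have h1 := huv.1
  by_cases he : s(u, v) = e
  · rw [he, setBit_self] at h1; simp at h1
  · rwa [setBit_of_ne _ he] at h1

variable [Fintype V]

lemma keep_univ (G : SimpleGraph V) : keep G Finset.univ = G := by
  ext u v
  simp [keep]

lemma Separated.compl {G : SimpleGraph V} {A : Finset V} (h : Separated G A) :
    Separated G Aᶜ := fun u hu v huv => by
  rw [Finset.mem_compl] at hu ⊢
  exact fun hv => hu (h v hv u huv.symm)

/-- The union of the connected components that meet `A`. -/
def cluster (G : SimpleGraph V) (A : Finset V) : Finset V :=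
  Finset.univ.filter fun x => ∃ a ∈ A, G.Reachable a x

/-- The vertex set of the connected component of `v`. -/
def compOf (G : SimpleGraph V) (v : V) : Finset V := cluster G {v}

lemma mem_cluster {G : SimpleGraph V} {A : Finset V} {x : V} :
    x ∈ cluster G A ↔ ∃ a ∈ A, G.Reachable a x := by simp [cluster]

lemma mem_compOf {G : SimpleGraph V} {v x : V} : x ∈ compOf G v ↔ G.Reachable v x := by
  simp [compOf, mem_cluster]

lemma self_mem_compOf (G : SimpleGraph V) (v : V) : v ∈ compOf G v :=
  mem_compOf.2 (SimpleGraph.Reachable.refl v)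

lemma subset_cluster (G : SimpleGraph V) (A : Finset V) : A ⊆ cluster G A := fun a ha =>
  mem_cluster.2 ⟨a, ha, SimpleGraph.Reachable.refl a⟩

lemma separated_cluster (G : SimpleGraph V) (A : Finset V) : Separated G (cluster G A) := by
  intro u hu v huv
  obtain ⟨a, ha, hau⟩ := mem_cluster.1 hu
  exact mem_cluster.2 ⟨a, ha, hau.trans huv.reachable⟩

lemma cluster_subset {G : SimpleGraph V} {A B : Finset V} (hAB : A ⊆ B) (hB : Separated G B) :
    cluster G A ⊆ B := fun x hx => by
  obtain ⟨a, ha, hax⟩ := mem_cluster.1 hx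
  exact hB.mem_of_reachable (hAB ha) hax

lemma separated_compOf (G : SimpleGraph V) (v : V) : Separated G (compOf G v) :=
  separated_cluster G {v}

lemma compOf_subset {G : SimpleGraph V} {v : V} {B : Finset V} (hv : v ∈ B)
    (hB : Separated G B) : compOf G v ⊆ B :=
  cluster_subset (by simpa using hv) hB

lemma compOf_eq_of_mem {G : SimpleGraph V} {u v : V} (h : u ∈ compOf G v) :
    compOf G u = compOf G v := by
  ext x
  rw [mem_compOf] at h
  rw [mem_compOf, mem_compOf]
  exact ⟨fun hx => h.trans hx, fun hx => h.symm.trans hx⟩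

lemma mem_compOf_comm {G : SimpleGraph V} {u v : V} : u ∈ compOf G v ↔ v ∈ compOf G u := by
  rw [mem_compOf, mem_compOf, SimpleGraph.reachable_comm]

lemma cluster_eq_biUnion (G : SimpleGraph V) (A : Finset V) :
    cluster G A = A.biUnion (compOf G) := by
  ext x
  simp [mem_cluster, mem_compOf]

lemma card_cluster_le (G : SimpleGraph V) (A : Finset V) :
    (cluster G A).card ≤ ∑ u ∈ A, (compOf G u).card := by
  rw [cluster_eq_biUnion]
  exact Finset.card_biUnion_le

lemma compOf_mono {G G' : SimpleGraph V} (h : G ≤ G') (v : V) : compOf G v ⊆ compOf G' v :=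
  fun _ hx => mem_compOf.2 ((mem_compOf.1 hx).mono h)

lemma card_compOf_pos (G : SimpleGraph V) (v : V) : 1 ≤ (compOf G v).card :=
  Finset.card_pos.2 ⟨v, self_mem_compOf G v⟩

/-- Graph functionals that are additive over unions of connected components, vanish on isolated
vertices and are bounded by the number of vertices. -/
structure ComponentAdditive (Y : SimpleGraph V → ℝ) : Prop where
  add : ∀ G A, Separated G A → Y G = Y (keep G A) + Y (keep G Aᶜ)
  bound : ∀ G A, |Y (keep G A)| ≤ A.card

namespace ComponentAdditive

variable {Y : SimpleGraph V → ℝ}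

lemma keep_eq (hY : ComponentAdditive Y) {G : SimpleGraph V} {K : Finset V} (hK : Separated G K)
    (B : Finset V) : Y (keep G B) = Y (keep G (B ∩ K)) + Y (keep G (B ∩ Kᶜ)) := by
  rw [hY.add (keep G B) K (hK.keep B), keep_keep, keep_keep]

lemma abs_keep_le (hY : ComponentAdditive Y) (G : SimpleGraph V) {A B : Finset V} (h : A ⊆ B) :
    |Y (keep G A)| ≤ B.card :=
  (hY.bound G A).trans (by exact_mod_cast Finset.card_le_card h)

end ComponentAdditive

/-- The share of the vertex `v` in the contribution of its component to `Y G`. -/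
def localTerm (Y : SimpleGraph V → ℝ) (v : V) (G : SimpleGraph V) : ℝ :=
  Y (keep G (compOf G v)) / (compOf G v).card

namespace ComponentAdditive

variable {Y : SimpleGraph V → ℝ}

lemma abs_localTerm_le (hY : ComponentAdditive Y) (v : V) (G : SimpleGraph V) :
    |localTerm Y v G| ≤ 1 := by
  unfold localTerm
  rw [abs_div, Nat.abs_cast]
  exact div_le_one_of_le₀ (hY.bound G _) (Nat.cast_nonneg _)

lemma sum_localTerm_of_separated (hY : ComponentAdditive Y) (G : SimpleGraph V) :
    ∀ B : Finset V, Separated G B → ∑ v ∈ B, localTerm Y v G = Y (keep G B) := by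
  intro B
  induction B using Finset.strongInduction with
  | H B ih =>
    intro hB
    rcases B.eq_empty_or_nonempty with rfl | ⟨v, hv⟩
    · have := hY.bound G ∅
      simp at this
      simp [this]
    · set C := compOf G v with hC
      have hCB : C ⊆ B := compOf_subset hv hB
      have hsep : Separated G (B \ C) := by
        intro u hu x hux
        rw [Finset.mem_sdiff] at hu ⊢
        exact ⟨hB u hu.1 x hux, fun hx => hu.2 (separated_compOf G v x hx u hux.symm)⟩
      have h1 := ih (B \ C) (Finset.sdiff_ssubset hCB ⟨v, self_mem_compOf G v⟩) hsep
      have h2 : ∑ u ∈ C, localTerm Y u G = Y (keep G C) := by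
        have : ∀ u ∈ C, localTerm Y u G = Y (keep G C) / C.card := fun u hu => by
          rw [localTerm, compOf_eq_of_mem hu]
        rw [Finset.sum_congr rfl this, Finset.sum_const, nsmul_eq_mul]
        have h3 : (C.card : ℝ) ≠ 0 := by
          have : 1 ≤ C.card := card_compOf_pos G v
          exact_mod_cast (by omega : C.card ≠ 0)
        field_simp
      rw [← Finset.sum_sdiff hCB, h1, h2, hY.keep_eq (separated_compOf G v) B, ← hC,
        Finset.inter_eq_right.2 hCB, ← Finset.sdiff_eq_inter_compl, add_comm]

lemma sum_localTerm (hY : ComponentAdditive Y) (G : SimpleGraph V) :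
    ∑ v, localTerm Y v G = Y G := by
  have := hY.sum_localTerm_of_separated G Finset.univ (fun _ _ v _ => Finset.mem_univ v)
  rwa [keep_univ] at this

end ComponentAdditive

/-- The pairs that meet `S`. -/
def touching (S : Finset V) : Set (Sym2 V) := {e | ∃ v ∈ S, v ∈ e}

lemma compOf_eq_of_agree {ω η : Sym2 V → Bool} {v : V} {S : Finset V}
    (h : ∀ e ∈ touching S, η e = ω e) (hS : compOf (cfgGraph ω) v = S) :
    compOf (cfgGraph η) v = S := by
  have hadj : ∀ x ∈ S, ∀ y, (cfgGraph η).Adj x y ↔ (cfgGraph ω).Adj x y := by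
    intro x hx y
    rw [cfgGraph_adj, cfgGraph_adj, h s(x, y) ⟨x, hx, by simp⟩]
  have hvS : v ∈ S := hS ▸ self_mem_compOf _ v
  have hsep : Separated (cfgGraph ω) S := hS ▸ separated_compOf _ v
  refine Finset.Subset.antisymm (compOf_subset hvS fun u hu x hux =>
    hsep u hu x ((hadj u hu x).1 hux)) fun x hx => ?_
  rw [← hS, mem_compOf] at hx
  have := reachable_induction (P := fun x => x ∈ S ∧ (cfgGraph η).Reachable v x)
    ⟨hvS, SimpleGraph.Reachable.refl v⟩ (fun x y hx hxy =>
      ⟨hsep x hx.1 y hxy, hx.2.trans ((hadj x hx.1 y).2 hxy).reachable⟩) hx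
  exact mem_compOf.2 this.2

/-- The increment of `Y` when the component of `v` in `ω` is planted into `ω'`. -/
def plantDiff (Y : SimpleGraph V → ℝ) (v : V) (ω ω' : Sym2 V → Bool) : ℝ :=
  Y (keep (cfgGraph ω) (compOf (cfgGraph ω) v)) +
    Y (keep (cfgGraph ω') (compOf (cfgGraph ω) v)ᶜ) - Y (cfgGraph ω')

variable {p : ℝ}

lemma ComponentAdditive.bernExp_localTerm_mul {Y : SimpleGraph V → ℝ} (hY : ComponentAdditive Y)
    (v : V) (φ : ℝ → ℝ) :
    bernExp p (fun ω => localTerm Y v (cfgGraph ω) * φ (Y (cfgGraph ω))) =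
      bernExp p (fun ω' => bernExp p (fun ω => localTerm Y v (cfgGraph ω) *
        φ (Y (cfgGraph ω') + plantDiff Y v ω ω'))) := by
  rw [bernExp_comm]
  have hsplit : ∀ (F : (Sym2 V → Bool) → ℝ) ω, F ω =
      ∑ S : Finset V, if compOf (cfgGraph ω) v = S then F ω else 0 := by
    intro F ω; simp
  rw [funext (hsplit fun ω => localTerm Y v (cfgGraph ω) * φ (Y (cfgGraph ω))),
    funext (hsplit fun ω => bernExp p fun ω' => localTerm Y v (cfgGraph ω) *
        φ (Y (cfgGraph ω') + plantDiff Y v ω ω')), bernExp_sum, bernExp_sum]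
  refine Finset.sum_congr rfl fun S _ => ?_
  rw [← bernExp_splice p (touching S)]
  congr 1
  ext ω
  have hag : ∀ ω', ∀ e ∈ touching S, splice (touching S) ω ω' e = ω e := by
    intro ω' e he; simp [splice, he]
  by_cases hS : compOf (cfgGraph ω) v = S
  · have h1 : ∀ ω', compOf (cfgGraph (splice (touching S) ω ω')) v = S := fun ω' =>
      compOf_eq_of_agree (hag ω') hS
    simp only [h1, hS, if_true]
    congr 1
    ext ω'
    have h2 : keep (cfgGraph (splice (touching S) ω ω')) S = keep (cfgGraph ω) S :=
      keep_cfgGraph_congr fun u hu w _ => hag ω' _ ⟨u, hu, by simp⟩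
    have h3 : keep (cfgGraph (splice (touching S) ω ω')) Sᶜ = keep (cfgGraph ω') Sᶜ := by
      refine keep_cfgGraph_congr fun u hu w hw => ?_
      have : s(u, w) ∉ touching S := by
        rintro ⟨x, hx, hxe⟩
        rw [Finset.mem_compl] at hu hw
        rcases Sym2.mem_iff.1 hxe with rfl | rfl
        · exact hu hx
        · exact hw hx
      simp [splice, this]
    have h4 : Separated (cfgGraph (splice (touching S) ω ω')) S := by
      have := separated_compOf (cfgGraph (splice (touching S) ω ω')) v
      rwa [h1 ω'] at this
    rw [localTerm, h1, h2, localTerm, hS, hY.add _ S h4, h2, h3, plantDiff, hS]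
    congr 2
    ring
  · have h1 : ∀ ω', compOf (cfgGraph (splice (touching S) ω ω')) v ≠ S := fun ω' h =>
      hS (compOf_eq_of_agree (fun e he => (hag ω' e he).symm) h)
    simp only [h1, hS, if_false, bernExp_const]

end Clusters

section Moments

variable {V : Type*} [Fintype V] {p m : ℝ}

/-- The fourth moments of all component sizes of the random graph are at most `m`. -/
def FourthMomentLE (V : Type*) [Fintype V] (p m : ℝ) : Prop :=
  ∀ v : V, bernExp p (fun ω : Sym2 V → Bool => ((compOf (cfgGraph ω) v).card : ℝ) ^ 4) ≤ m

lemma one_le_card_compOf (G : SimpleGraph V) (v : V) : (1 : ℝ) ≤ (compOf G v).card := by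
  exact_mod_cast card_compOf_pos G v

lemma FourthMomentLE.pow (hm : FourthMomentLE V p m) (hp0 : 0 ≤ p) (hp1 : p ≤ 1) {k : ℕ}
    (hk : k ≤ 4) (v : V) :
    bernExp p (fun ω : Sym2 V → Bool => ((compOf (cfgGraph ω) v).card : ℝ) ^ k) ≤ m :=
  (bernExp_mono hp0 hp1 fun _ => pow_le_pow_right₀ (one_le_card_compOf _ v) hk).trans (hm v)

lemma FourthMomentLE.one_le (hm : FourthMomentLE V p m) (hp0 : 0 ≤ p) (hp1 : p ≤ 1) (v : V) :
    1 ≤ m := by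
  simpa [bernExp_const] using hm.pow hp0 hp1 (Nat.zero_le 4) v

lemma FourthMomentLE.one (hm : FourthMomentLE V p m) (hp0 : 0 ≤ p) (hp1 : p ≤ 1) (v : V) :
    bernExp p (fun ω : Sym2 V → Bool => ((compOf (cfgGraph ω) v).card : ℝ)) ≤ m := by
  simpa using hm.pow hp0 hp1 (show 1 ≤ 4 by norm_num) v

lemma ComponentAdditive.abs_plantDiff_le {Y : SimpleGraph V → ℝ} (hY : ComponentAdditive Y)
    (v : V) (ω ω' : Sym2 V → Bool) :
    |plantDiff Y v ω ω'| ≤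
      3 * ∑ u ∈ compOf (cfgGraph ω) v, ((compOf (cfgGraph ω') u).card : ℝ) := by
  set C := compOf (cfgGraph ω) v
  set K := cluster (cfgGraph ω') C
  have hK : Separated (cfgGraph ω') K := separated_cluster _ _
  have hCK : C ⊆ K := subset_cluster _ _
  have hcard : (K.card : ℝ) ≤ ∑ u ∈ C, ((compOf (cfgGraph ω') u).card : ℝ) := by
    exact_mod_cast card_cluster_le (cfgGraph ω') C
  have h1 : Y (keep (cfgGraph ω') Cᶜ) =
      Y (keep (cfgGraph ω') (Cᶜ ∩ K)) + Y (keep (cfgGraph ω') Kᶜ) := by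
    rw [hY.keep_eq hK, Finset.inter_eq_right.2 (Finset.compl_subset_compl.2 hCK)]
  have h2 := hY.add (cfgGraph ω') K hK
  have h3 := abs_le.1 (hY.abs_keep_le (cfgGraph ω) hCK)
  have h4 := abs_le.1 (hY.abs_keep_le (cfgGraph ω') (Finset.inter_subset_right : Cᶜ ∩ K ⊆ K))
  have h5 := abs_le.1 (hY.bound (cfgGraph ω') K)
  refine le_trans ?_ (mul_le_mul_of_nonneg_left hcard (by norm_num))
  change |Y (keep (cfgGraph ω) C) + Y (keep (cfgGraph ω') Cᶜ) - Y (cfgGraph ω')| ≤ _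
  rw [h1, h2]
  exact abs_le.2 ⟨by linarith, by linarith⟩

lemma ComponentAdditive.bernExp_plantDiff_sq_le {Y : SimpleGraph V → ℝ}
    (hY : ComponentAdditive Y) (hp0 : 0 ≤ p) (hp1 : p ≤ 1) (hm : FourthMomentLE V p m) (v : V) :
    bernExp p (fun ω' => bernExp p (fun ω => plantDiff Y v ω ω' ^ 2)) ≤ 9 * m ^ 2 := by
  rw [bernExp_comm]
  have hm1 := hm.one_le hp0 hp1 v
  have hinner : ∀ ω : Sym2 V → Bool, bernExp p (fun ω' => plantDiff Y v ω ω' ^ 2) ≤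
      9 * m * ((compOf (cfgGraph ω) v).card : ℝ) ^ 2 := by
    intro ω
    set C := compOf (cfgGraph ω) v with hC
    calc bernExp p (fun ω' => plantDiff Y v ω ω' ^ 2)
        ≤ bernExp p (fun ω' => 9 * C.card *
            ∑ u ∈ C, ((compOf (cfgGraph ω') u).card : ℝ) ^ 2) := by
          refine bernExp_mono hp0 hp1 fun ω' => ?_
          have h1 := hY.abs_plantDiff_le v ω ω'
          rw [← hC] at h1
          have h2 : (∑ u ∈ C, ((compOf (cfgGraph ω') u).card : ℝ)) ^ 2 ≤
              C.card * ∑ u ∈ C, ((compOf (cfgGraph ω') u).card : ℝ) ^ 2 :=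
            sq_sum_le_card_mul_sum_sq
          have h3 := pow_le_pow_left₀ (abs_nonneg _) h1 2
          rw [sq_abs] at h3
          linarith
      _ = 9 * C.card * ∑ u ∈ C, bernExp p (fun ω' : Sym2 V → Bool =>
            ((compOf (cfgGraph ω') u).card : ℝ) ^ 2) := by
          rw [bernExp_mul_left, bernExp_sum]
      _ ≤ 9 * C.card * ∑ _u ∈ C, m := by
          refine mul_le_mul_of_nonneg_left (Finset.sum_le_sum fun u _ => ?_) (by positivity)
          exact hm.pow hp0 hp1 (by norm_num) u
      _ = 9 * m * (C.card : ℝ) ^ 2 := by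
          rw [Finset.sum_const, nsmul_eq_mul]
          ring
  refine (bernExp_mono hp0 hp1 hinner).trans ?_
  rw [bernExp_mul_left]
  have := hm.pow hp0 hp1 (show 2 ≤ 4 by norm_num) v
  calc 9 * m * _ ≤ 9 * m * m := mul_le_mul_of_nonneg_left this (by linarith)
    _ = 9 * m ^ 2 := by ring

/-- The union of the components of `a` and `b` after deleting the edge `ab`. -/
def edgeHull (a b : V) (ω : Sym2 V → Bool) : Finset V :=
  compOf (cfgGraph (setBit ω s(a, b) false)) a ∪
    compOf (cfgGraph (setBit ω s(a, b) false)) b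

lemma cfgGraph_setBit_adj (ω : Sym2 V → Bool) (a b : V) (t : Bool) {u v : V}
    (h : ¬(u ∈ edgeHull a b ω ∧ v ∈ edgeHull a b ω)) :
    (cfgGraph (setBit ω s(a, b) t)).Adj u v ↔
      (cfgGraph (setBit ω s(a, b) false)).Adj u v := by
  have hne : s(u, v) ≠ s(a, b) := by
    intro he
    apply h
    have ha : a ∈ edgeHull a b ω := Finset.mem_union_left _ (self_mem_compOf _ _)
    have hb : b ∈ edgeHull a b ω := Finset.mem_union_right _ (self_mem_compOf _ _)
    rcases Sym2.eq_iff.1 he with ⟨rfl, rfl⟩ | ⟨rfl, rfl⟩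
    · exact ⟨ha, hb⟩
    · exact ⟨hb, ha⟩
  simp [cfgGraph_adj, setBit_of_ne _ hne]

lemma separated_edgeHull (ω : Sym2 V → Bool) (a b : V) (t : Bool) :
    Separated (cfgGraph (setBit ω s(a, b) t)) (edgeHull a b ω) := by
  intro u hu v huv
  by_contra hv
  rw [cfgGraph_setBit_adj ω a b t (fun h => hv h.2)] at huv
  rcases Finset.mem_union.1 hu with h | h
  · exact hv (Finset.mem_union_left _ (separated_compOf _ _ u h v huv))
  · exact hv (Finset.mem_union_right _ (separated_compOf _ _ u h v huv))

lemma keep_setBit_compl_edgeHull (ω : Sym2 V → Bool) (a b : V) (B : Finset V) (t : Bool) :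
    keep (cfgGraph (setBit ω s(a, b) t)) (B ∩ (edgeHull a b ω)ᶜ) =
      keep (cfgGraph (setBit ω s(a, b) false)) (B ∩ (edgeHull a b ω)ᶜ) := by
  ext u v
  simp only [keep]
  refine and_congr_left fun h => cfgGraph_setBit_adj ω a b t fun h' => ?_
  have := (Finset.mem_inter.1 h.1).2
  exact (Finset.mem_compl.1 this) h'.1

lemma card_edgeHull_le (ω : Sym2 V → Bool) (a b : V) :
    ((edgeHull a b ω).card : ℝ) ≤
      (compOf (cfgGraph ω) a).card + (compOf (cfgGraph ω) b).card := by
  have hle := cfgGraph_setBit_false_le ω s(a, b)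
  have h := (Finset.card_union_le _ _).trans (add_le_add
    (Finset.card_le_card (compOf_mono hle a)) (Finset.card_le_card (compOf_mono hle b)))
  exact_mod_cast h

lemma FourthMomentLE.edgeHull (hm : FourthMomentLE V p m) (hp0 : 0 ≤ p) (hp1 : p ≤ 1) (a b : V) :
    bernExp p (fun ω : Sym2 V → Bool => ((edgeHull a b ω).card : ℝ) ^ 4) ≤ 16 * m := by
  calc bernExp p (fun ω : Sym2 V → Bool => ((MetricDimPaper.edgeHull a b ω).card : ℝ) ^ 4)
      ≤ bernExp p (fun ω : Sym2 V → Bool => 8 * ((compOf (cfgGraph ω) a).card : ℝ) ^ 4 +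
          8 * ((compOf (cfgGraph ω) b).card : ℝ) ^ 4) := by
        refine bernExp_mono hp0 hp1 fun ω => ?_
        refine (pow_le_pow_left₀ (Nat.cast_nonneg _) (card_edgeHull_le ω a b) 4).trans ?_
        have := add_pow_le (Nat.cast_nonneg (α := ℝ) (compOf (cfgGraph ω) a).card)
          (Nat.cast_nonneg (α := ℝ) (compOf (cfgGraph ω) b).card) 4
        norm_num at this
        linarith
    _ ≤ 16 * m := by
        rw [bernExp_add, bernExp_mul_left, bernExp_mul_left]
        linarith [hm a, hm b]

/-- The conditional expected increment, whose expectation is the variance of `Y`. -/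
def plantMean (p : ℝ) (Y : SimpleGraph V → ℝ) (ω' : Sym2 V → Bool) : ℝ :=
  ∑ v, bernExp p (fun ω => localTerm Y v (cfgGraph ω) * plantDiff Y v ω ω')

lemma ComponentAdditive.abs_flipDiff_plantDiff_le {Y : SimpleGraph V → ℝ}
    (hY : ComponentAdditive Y) (v a b : V) (ω ω' : Sym2 V → Bool) :
    |flipDiff s(a, b) (plantDiff Y v ω) ω'| ≤ 4 * (edgeHull a b ω').card *
      ∑ k ∈ edgeHull a b ω', if v ∈ compOf (cfgGraph ω) k then (1 : ℝ) else 0 := by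
  set K := edgeHull a b ω' with hKdef
  set C := compOf (cfgGraph ω) v with hC
  set G : Bool → SimpleGraph V := fun t => cfgGraph (setBit ω' s(a, b) t) with hG
  have hsep : ∀ t, Separated (G t) K := separated_edgeHull ω' a b
  have hk : ∀ B t, Y (keep (G t) B) =
      Y (keep (G t) (B ∩ K)) + Y (keep (G false) (B ∩ Kᶜ)) := by
    intro B t
    rw [hY.keep_eq (hsep t) B, hKdef, hG, keep_setBit_compl_edgeHull]
  have hflip : flipDiff s(a, b) (plantDiff Y v ω) ω' =
      (Y (keep (G true) (Cᶜ ∩ K)) - Y (keep (G true) K)) -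
      (Y (keep (G false) (Cᶜ ∩ K)) - Y (keep (G false) K)) := by
    have hu : ∀ t, Y (G t) = Y (keep (G t) K) + Y (keep (G false) Kᶜ) := by
      intro t
      have := hk Finset.univ t
      simpa [keep_univ] using this
    have h1 : flipDiff s(a, b) (plantDiff Y v ω) ω' =
      (Y (keep (G true) Cᶜ) - Y (G true)) - (Y (keep (G false) Cᶜ) - Y (G false)) := by
      simp only [flipDiff, plantDiff, hG, ← hC]
      ring
    rw [h1, hk Cᶜ true, hk Cᶜ false, hu true, hu false]
    ring
  have hsum0 : ∀ k, (0 : ℝ) ≤ if v ∈ compOf (cfgGraph ω) k then (1 : ℝ) else 0 := by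
    exact fun k => ite_nonneg zero_le_one le_rfl
  by_cases hdisj : Disjoint C K
  · have : Cᶜ ∩ K = K := Finset.inter_eq_right.2 fun x hx =>
      Finset.mem_compl.2 fun hxC => Finset.disjoint_left.1 hdisj hxC hx
    rw [hflip, this]
    simp only [sub_self, abs_zero]
    exact mul_nonneg (mul_nonneg zero_le_four (Nat.cast_nonneg _))
      (Finset.sum_nonneg fun k _ => hsum0 k)
  · obtain ⟨k, hkC, hkK⟩ := Finset.not_disjoint_iff.1 hdisj
    have h1 : (1 : ℝ) ≤ ∑ k ∈ K, if v ∈ compOf (cfgGraph ω) k then (1 : ℝ) else 0 := by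
      have := Finset.single_le_sum (f := fun k => if v ∈ compOf (cfgGraph ω) k then (1 : ℝ) else 0)
        (fun k _ => hsum0 k) hkK
      rw [if_pos (mem_compOf_comm.1 hkC)] at this
      exact this
    have h2 := fun t => abs_le.1 (hY.abs_keep_le (G t) (Finset.inter_subset_right : Cᶜ ∩ K ⊆ K))
    have h3 := fun t => abs_le.1 (hY.bound (G t) K)
    have h4 : |flipDiff s(a, b) (plantDiff Y v ω) ω'| ≤ 4 * K.card := by
      rw [hflip]
      exact abs_le.2 ⟨by linarith [h2 true, h2 false, h3 true, h3 false],
        by linarith [h2 true, h2 false, h3 true, h3 false]⟩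
    exact h4.trans (le_mul_of_one_le_right (mul_nonneg zero_le_four (Nat.cast_nonneg _)) h1)

lemma ComponentAdditive.abs_flipDiff_plantMean_le {Y : SimpleGraph V → ℝ}
    (hY : ComponentAdditive Y) (hp0 : 0 ≤ p) (hp1 : p ≤ 1) (hm : FourthMomentLE V p m)
    (a b : V) (ω' : Sym2 V → Bool) :
    |flipDiff s(a, b) (plantMean p Y) ω'| ≤ 4 * m * ((edgeHull a b ω').card : ℝ) ^ 2 := by
  set K := edgeHull a b ω' with hKdef
  have h1 : flipDiff s(a, b) (plantMean p Y) ω' = bernExp p (fun ω => ∑ v,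
      localTerm Y v (cfgGraph ω) * flipDiff s(a, b) (plantDiff Y v ω) ω') := by
    rw [bernExp_sum]
    simp only [flipDiff, plantMean, mul_sub, bernExp_sub, Finset.sum_sub_distrib]
  rw [h1]
  refine (abs_bernExp_le hp0 hp1 _).trans ?_
  calc bernExp p (fun ω => |∑ v,
        localTerm Y v (cfgGraph ω) * flipDiff s(a, b) (plantDiff Y v ω) ω'|)
      ≤ bernExp p (fun ω => 4 * K.card * ∑ k ∈ K, ((compOf (cfgGraph ω) k).card : ℝ)) := by
        refine bernExp_mono hp0 hp1 fun ω => ?_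
        refine (Finset.abs_sum_le_sum_abs _ _).trans ?_
        have : ∀ v ∈ Finset.univ,
            |localTerm Y v (cfgGraph ω) * flipDiff s(a, b) (plantDiff Y v ω) ω'| ≤
            4 * K.card * ∑ k ∈ K, if v ∈ compOf (cfgGraph ω) k then (1 : ℝ) else 0 := by
          intro v _
          rw [abs_mul]
          exact (mul_le_of_le_one_left (abs_nonneg _) (hY.abs_localTerm_le v _)).trans
            (hY.abs_flipDiff_plantDiff_le v a b ω ω')
        refine (Finset.sum_le_sum this).trans (le_of_eq ?_)
        rw [← Finset.mul_sum, Finset.sum_comm]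
        simp
    _ = 4 * K.card * ∑ k ∈ K, bernExp p (fun ω : Sym2 V → Bool =>
          ((compOf (cfgGraph ω) k).card : ℝ)) := by
        rw [bernExp_mul_left, bernExp_sum]
    _ ≤ 4 * K.card * ∑ _k ∈ K, m :=
        mul_le_mul_of_nonneg_left (Finset.sum_le_sum fun k _ => hm.one hp0 hp1 k) (by positivity)
    _ = 4 * m * (K.card : ℝ) ^ 2 := by
        rw [Finset.sum_const, nsmul_eq_mul]
        ring

lemma ComponentAdditive.bernVar_plantMean_le {Y : SimpleGraph V → ℝ}
    (hY : ComponentAdditive Y) (hp0 : 0 ≤ p) (hp1 : p ≤ 1) (hm : FourthMomentLE V p m) :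
    bernVar p (plantMean p Y) ≤ p * Fintype.card (Sym2 V) * (256 * m ^ 3) := by
  refine (bernVar_le_sum_flipDiff hp0 hp1 _).trans ?_
  have h : ∀ e : Sym2 V, bernExp p (fun ω => flipDiff e (plantMean p Y) ω ^ 2) ≤
      256 * m ^ 3 := by
    intro e
    induction e using Sym2.ind with
    | _ a b =>
      have hm1 := hm.one_le hp0 hp1 a
      calc bernExp p (fun ω => flipDiff s(a, b) (plantMean p Y) ω ^ 2)
          ≤ bernExp p (fun ω => 16 * m ^ 2 * ((MetricDimPaper.edgeHull a b ω).card : ℝ) ^ 4) := by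
            refine bernExp_mono hp0 hp1 fun ω => ?_
            have := pow_le_pow_left₀ (abs_nonneg _)
              (hY.abs_flipDiff_plantMean_le hp0 hp1 hm a b ω) 2
            rw [sq_abs] at this
            refine this.trans (le_of_eq (by ring))
        _ ≤ 16 * m ^ 2 * (16 * m) := by
            rw [bernExp_mul_left]
            exact mul_le_mul_of_nonneg_left (hm.edgeHull hp0 hp1 a b) (by positivity)
        _ = 256 * m ^ 3 := by ring
  calc p * (1 - p) * ∑ e, bernExp p (fun ω => flipDiff e (plantMean p Y) ω ^ 2)
      ≤ p * (1 - p) * ∑ _e : Sym2 V, 256 * m ^ 3 :=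
        mul_le_mul_of_nonneg_left (Finset.sum_le_sum fun e _ => h e)
          (mul_nonneg hp0 (by linarith))
    _ = (1 - p) * (p * Fintype.card (Sym2 V) * (256 * m ^ 3)) := by
        rw [Finset.sum_const, nsmul_eq_mul, Finset.card_univ]
        ring
    _ ≤ p * Fintype.card (Sym2 V) * (256 * m ^ 3) := by
        refine mul_le_of_le_one_left ?_ (by linarith)
        rcases isEmpty_or_nonempty V with hV | ⟨⟨v⟩⟩
        · simp
        · have := hm.one_le hp0 hp1 v
          positivity

/-- Normal approximation for component-additive functionals of the random graph. -/
lemma ComponentAdditive.abs_bernExp_sub_gaussInt_le {Y : SimpleGraph V → ℝ}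
    (hY : ComponentAdditive Y) (hp0 : 0 ≤ p) (hp1 : p ≤ 1) (hm : FourthMomentLE V p m) {σ : ℝ}
    (hσ : 0 < σ) (hvar : σ ^ 2 = bernVar p fun ω => Y (cfgGraph ω))
    {h : ℝ → ℝ} (hd : Differentiable ℝ h) {H H' : ℝ}
    (hH : ∀ x, |h x| ≤ H) (hH' : ∀ x, |deriv h x| ≤ H') :
    |bernExp p (fun ω => h ((Y (cfgGraph ω) - bernExp p fun ω => Y (cfgGraph ω)) / σ)) -
        gaussInt h| ≤
      4 * H * Real.sqrt (p * Fintype.card (Sym2 V) * (256 * m ^ 3)) / σ ^ 2 +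
        (20 * H + 2 * H') * (Fintype.card V * (9 * m ^ 2)) / σ ^ 3 :=
  MetricDimPaper.abs_bernExp_sub_gaussInt_le hp0 hp1 (fun ω => Y (cfgGraph ω))
    (fun v ω => localTerm Y v (cfgGraph ω)) (plantDiff Y)
    (fun ω => hY.sum_localTerm (cfgGraph ω)) (fun v φ => hY.bernExp_localTerm_mul v φ)
    (fun v _ => hY.abs_localTerm_le v _) (fun v => hY.bernExp_plantDiff_sq_le hp0 hp1 hm v)
    (hY.bernVar_plantMean_le hp0 hp1 hm) hσ hvar hd hH hH'

end Moments

section Subcritical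

variable {V : Type*} [Fintype V] {p : ℝ}

lemma cluster_splice_subset (ω ω' : Sym2 V → Bool) {U A : Finset V} {v : V} :
    cluster (keep (cfgGraph (splice {e | v ∈ e} ω ω')) U) A ⊆
      insert v (cluster (keep (cfgGraph ω') (U.erase v))
        (A.erase v ∪ (U \ A).filter fun u => ω s(v, u) = true)) := by
  set D := A.erase v ∪ (U \ A).filter fun u => ω s(v, u) = true with hD
  set η := splice {e | v ∈ e} ω ω' with hη
  refine cluster_subset (fun a ha => ?_) fun x hx y hxy => ?_
  · by_cases hav : a = v
    · simp [hav]
    · exact Finset.mem_insert_of_mem (subset_cluster _ _ (by simp [hD, hav, ha]))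
  · obtain ⟨h1, hxU, hyU⟩ := hxy
    rw [cfgGraph_adj] at h1
    by_cases hyv : y = v
    · simp [hyv]
    refine Finset.mem_insert_of_mem ?_
    by_cases hxv : x = v
    · refine subset_cluster _ _ ?_
      have h2 : ω s(v, y) = true := by
        have := h1.1
        rw [hxv] at this
        simpa [hη, splice] using this
      by_cases hyA : y ∈ A
      · simp [hD, hyA, hyv]
      · simp [hD, hyA, hyU, h2]
    · have hxc := (Finset.mem_insert.1 hx).resolve_left hxv
      refine separated_cluster _ _ x hxc y ⟨?_, ?_, ?_⟩
      · rw [cfgGraph_adj]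
        refine ⟨?_, h1.2⟩
        have := h1.1
        simpa [hη, splice, Ne.symm hxv, Ne.symm hyv] using this
      · simp [hxv, hxU]
      · simp [hyv, hyU]

lemma bernExp_pow_card_filter_le (hp0 : 0 ≤ p) {M : ℝ} (hM : 1 ≤ M) (v : V) (W : Finset V) :
    bernExp p (fun ω : Sym2 V → Bool => M ^ (W.filter fun u => ω s(v, u) = true).card) ≤
      Real.exp (p * Fintype.card V * (M - 1)) := by
  have hinj : Set.InjOn (fun u => s(v, u)) (W : Set V) := fun a _ b _ h => Sym2.congr_right.1 h
  have h1 : ∀ ω : Sym2 V → Bool, M ^ (W.filter fun u => ω s(v, u) = true).card =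
      ∏ e ∈ W.image (fun u => s(v, u)), if ω e = true then M else 1 := by
    intro ω
    rw [Finset.prod_image hinj, Finset.prod_ite]
    simp
  simp_rw [h1]
  rw [bernExp_finset_prod p _ fun b => if b = true then M else 1, Finset.card_image_of_injOn hinj]
  have h2 : p * (if true = true then M else 1) + (1 - p) * (if false = true then M else 1) =
      p * (M - 1) + 1 := by
    simp
    ring
  rw [h2]
  have h3 : 0 ≤ p * (M - 1) := mul_nonneg hp0 (by linarith)
  calc (p * (M - 1) + 1) ^ W.card ≤ (p * (M - 1) + 1) ^ Fintype.card V :=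
        pow_le_pow_right₀ (by linarith) (Finset.card_le_univ W)
    _ ≤ Real.exp (p * (M - 1)) ^ Fintype.card V :=
        pow_le_pow_left₀ (by linarith) (Real.add_one_le_exp _) _
    _ = Real.exp (p * Fintype.card V * (M - 1)) := by
        rw [← Real.exp_nat_mul]
        ring_nf

/-- Exponential moments of component sizes in the subcritical regime. -/
lemma bernExp_pow_card_cluster_le (hp0 : 0 ≤ p) (hp1 : p ≤ 1) {M θ : ℝ} (hM : 1 ≤ M)
    (hθ : 1 ≤ θ) (h : θ * Real.exp (p * Fintype.card V * (M - 1)) ≤ M) (U : Finset V) :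
    ∀ A ⊆ U, bernExp p (fun ω => θ ^ (cluster (keep (cfgGraph ω) U) A).card) ≤ M ^ A.card := by
  induction U using Finset.strongInduction with
  | H U ih =>
    intro A hA
    rcases A.eq_empty_or_nonempty with rfl | ⟨v, hv⟩
    · simp [cluster, bernExp_const]
    have hθ0 : 0 ≤ θ := by linarith
    have hM0 : 0 ≤ M := by linarith
    set N : (Sym2 V → Bool) → Finset V := fun ω => (U \ A).filter fun u => ω s(v, u) = true
      with hN
    have hsub : ∀ ω, A.erase v ∪ N ω ⊆ U.erase v := by
      intro ω x hx
      rcases Finset.mem_union.1 hx with hx | hx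
      · exact Finset.erase_subset_erase _ hA hx
      · have h1 := Finset.mem_sdiff.1 (Finset.mem_filter.1 hx).1
        exact Finset.mem_erase.2 ⟨fun hxv => h1.2 (hxv ▸ hv), h1.1⟩
    rw [← bernExp_splice p {e | v ∈ e}]
    calc bernExp p (fun ω => bernExp p fun ω' =>
          θ ^ (cluster (keep (cfgGraph (splice {e | v ∈ e} ω ω')) U) A).card)
        ≤ bernExp p (fun ω => bernExp p fun ω' => θ *
            θ ^ (cluster (keep (cfgGraph ω') (U.erase v)) (A.erase v ∪ N ω)).card) := by
          refine bernExp_mono hp0 hp1 fun ω => bernExp_mono hp0 hp1 fun ω' => ?_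
          rw [← pow_succ']
          refine pow_le_pow_right₀ hθ ((Finset.card_le_card
            (cluster_splice_subset ω ω')).trans (Finset.card_insert_le _ _))
      _ ≤ bernExp p (fun ω => θ * (M ^ (A.erase v).card * M ^ (N ω).card)) := by
          refine bernExp_mono hp0 hp1 fun ω => ?_
          rw [bernExp_mul_left]
          refine mul_le_mul_of_nonneg_left ?_ hθ0
          refine (ih _ (Finset.erase_ssubset (hA hv)) _ (hsub ω)).trans ?_
          rw [← pow_add]
          exact pow_le_pow_right₀ hM (Finset.card_union_le _ _)
      _ = θ * (M ^ (A.erase v).card * bernExp p fun ω => M ^ (N ω).card) := by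
          rw [bernExp_mul_left, bernExp_mul_left]
      _ ≤ θ * (M ^ (A.erase v).card * Real.exp (p * Fintype.card V * (M - 1))) :=
          mul_le_mul_of_nonneg_left (mul_le_mul_of_nonneg_left
            (bernExp_pow_card_filter_le hp0 hM v _) (by positivity)) hθ0
      _ = θ * Real.exp (p * Fintype.card V * (M - 1)) * M ^ (A.erase v).card := by ring
      _ ≤ M * M ^ (A.erase v).card := mul_le_mul_of_nonneg_right h (by positivity)
      _ = M ^ A.card := by
          rw [← pow_succ', Finset.card_erase_add_one hv]

/-- In the subcritical regime the fourth moments of component sizes are uniformly bounded. -/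
lemma exists_fourthMomentLE {c : ℝ} (hc1 : c < 1) :
    ∃ m : ℝ, 1 ≤ m ∧ ∀ (n : ℕ) (p : ℝ), 0 ≤ p → p ≤ 1 → p * n ≤ c →
      FourthMomentLE (Fin n) p m := by
  set δ := (1 - c) / 2 with hδ
  have hδ0 : 0 < δ := by rw [hδ]; linarith
  set θ := (1 + δ) * Real.exp (-(c * δ)) with hθdef
  have hθ : 1 < θ := by
    have h1 : 1 - c * δ ≤ Real.exp (-(c * δ)) := by
      have := Real.add_one_le_exp (-(c * δ))
      linarith
    have h2 : (1 + δ) * (1 - c * δ) ≤ θ := mul_le_mul_of_nonneg_left h1 (by linarith)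
    have h3 : 0 < δ * ((1 - c) - c * δ) := mul_pos hδ0 (by rw [hδ]; nlinarith)
    nlinarith
  have hlog : 0 < Real.log θ := Real.log_pos hθ
  refine ⟨max 1 (24 / Real.log θ ^ 4 * (1 + δ)), le_max_left _ _, fun n p hp0 hp1 hpc v => ?_⟩
  refine le_trans ?_ (le_max_right _ _)
  have hcond : θ * Real.exp (p * Fintype.card (Fin n) * ((1 + δ) - 1)) ≤ 1 + δ := by
    rw [hθdef, mul_assoc, ← Real.exp_add, Fintype.card_fin]
    refine mul_le_of_le_one_right (by linarith) (Real.exp_le_one_iff.2 ?_)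
    have := mul_le_mul_of_nonneg_right hpc hδ0.le
    linarith
  have h1 := bernExp_pow_card_cluster_le hp0 hp1 (by linarith : (1 : ℝ) ≤ 1 + δ) hθ.le hcond
    Finset.univ {v} (Finset.subset_univ _)
  simp only [keep_univ, Finset.card_singleton, pow_one] at h1
  calc bernExp p (fun ω => ((compOf (cfgGraph ω) v).card : ℝ) ^ 4)
      ≤ bernExp p (fun ω => 24 / Real.log θ ^ 4 * θ ^ (cluster (cfgGraph ω) {v}).card) := by
        refine bernExp_mono hp0 hp1 fun ω => ?_
        change ((compOf (cfgGraph ω) v).card : ℝ) ^ 4 ≤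
          24 / Real.log θ ^ 4 * θ ^ (compOf (cfgGraph ω) v).card
        set k := (compOf (cfgGraph ω) v).card
        have h2 := Real.pow_div_factorial_le_exp ((k : ℝ) * Real.log θ) (by positivity) 4
        rw [Real.exp_nat_mul, Real.exp_log (by linarith)] at h2
        have h3 : ((4 : ℕ).factorial : ℝ) = 24 := by norm_num [Nat.factorial]
        rw [h3, mul_pow, div_le_iff₀ (by norm_num)] at h2
        rw [div_mul_eq_mul_div, le_div_iff₀ (by positivity)]
        linarith
    _ ≤ 24 / Real.log θ ^ 4 * (1 + δ) := by
        rw [bernExp_mul_left]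
        exact mul_le_mul_of_nonneg_left h1 (by positivity)

end Subcritical

section Resolving

variable {V : Type*}

lemma le_edist_of_lipschitz {G : SimpleGraph V} {w : V} {φ : V → ℕ∞} (hw : φ w = 0)
    (h : ∀ x y, G.Adj x y → φ x ≤ φ y + 1) (x : V) : φ x ≤ G.edist x w := by
  refine le_iInf fun q => ?_
  induction q with
  | nil => simp [hw]
  | @cons a b _ hab q ih =>
    rw [SimpleGraph.Walk.length_cons, Nat.cast_add, Nat.cast_one]
    exact (h a b hab).trans (add_le_add (ih hw) le_rfl)

lemma edist_le_add_one {G : SimpleGraph V} {x y : V} (h : G.Adj x y) (w : V) :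
    G.edist x w ≤ G.edist y w + 1 := by
  have := SimpleGraph.edist_triangle (G := G) (u := x) (v := y) (w := w)
  rwa [SimpleGraph.edist_eq_one_iff_adj.2 h, add_comm] at this

lemma keep_le (G : SimpleGraph V) (A : Finset V) : keep G A ≤ G := fun _ _ h => h.1

lemma edist_keep {G : SimpleGraph V} {A : Finset V} (hA : Separated G A) {u : V} (hu : u ∈ A)
    (w : V) : (keep G A).edist u w = G.edist u w := by
  refine le_antisymm ?_ (SimpleGraph.edist_anti (keep_le G A))
  refine le_trans ?_ (le_edist_of_lipschitz (w := w)
    (φ := fun x => if x ∈ A then (keep G A).edist x w else 0) (by simp) ?_ u)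
  · simp [hu]
  · intro x y hxy
    by_cases hx : x ∈ A
    · have hy := hA x hx y hxy
      simp only [hx, hy, if_true]
      exact edist_le_add_one (show (keep G A).Adj x y from ⟨hxy, hx, hy⟩) w
    · simp [hx]

lemma reachable_keep {G : SimpleGraph V} {A : Finset V} (hA : Separated G A) {u : V} (hu : u ∈ A)
    {w : V} : (keep G A).Reachable u w ↔ G.Reachable u w := by
  rw [← SimpleGraph.edist_ne_top_iff_reachable, edist_keep hA hu,
    SimpleGraph.edist_ne_top_iff_reachable]

lemma eq_of_reachable_of_isolated {G : SimpleGraph V} {u w : V} (hu : ∀ x, ¬G.Adj u x)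
    (h : G.Reachable u w) : w = u :=
  reachable_induction (P := fun x => x = u) rfl
    (fun _ y hx hxy => absurd (hx ▸ hxy) (hu y)) h

/-- `R` meets every component of `G` and resolves each component. -/
def StrongResolves (G : SimpleGraph V) (R : Finset V) : Prop :=
  (∀ u, ∃ w ∈ R, G.Reachable u w) ∧
    ∀ u v, u ≠ v → G.Reachable u v → ∃ w ∈ R, G.edist u w ≠ G.edist v w

lemma StrongResolves.mem_of_isolated {G : SimpleGraph V} {R : Finset V} (h : StrongResolves G R)
    {u : V} (hu : ∀ x, ¬G.Adj u x) : u ∈ R := by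
  obtain ⟨w, hw, huw⟩ := h.1 u
  exact eq_of_reachable_of_isolated hu huw ▸ hw

lemma reachable_of_edist_ne {G : SimpleGraph V} {u v w : V} (huv : G.Reachable u v)
    (h : G.edist u w ≠ G.edist v w) : G.Reachable u w := by
  by_contra hu
  have hv : ¬G.Reachable v w := fun hv => hu (huv.trans hv)
  rw [SimpleGraph.edist_eq_top_of_not_reachable hu,
    SimpleGraph.edist_eq_top_of_not_reachable hv] at h
  exact h rfl

lemma edist_sup_edge {G : SimpleGraph V} {a b : V} (hab : ¬G.Reachable a b) (x w : V) :
    (G ⊔ SimpleGraph.edge a b).edist x w =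
      min (G.edist x w) (min (G.edist x a + 1 + G.edist b w) (G.edist x b + 1 + G.edist a w)) := by
  have hne : a ≠ b := fun h => hab (h ▸ SimpleGraph.Reachable.refl a)
  have hle : G ≤ G ⊔ SimpleGraph.edge a b := le_sup_left
  have hadj : (G ⊔ SimpleGraph.edge a b).Adj a b := by
    simp [SimpleGraph.edge_adj, hne]
  have hvia : ∀ y z, (G ⊔ SimpleGraph.edge a b).Adj y z →
      (G ⊔ SimpleGraph.edge a b).edist x w ≤ G.edist x y + 1 + G.edist z w := by
    intro y z hyz
    calc (G ⊔ SimpleGraph.edge a b).edist x w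
        ≤ (G ⊔ SimpleGraph.edge a b).edist x y + (G ⊔ SimpleGraph.edge a b).edist y w :=
          SimpleGraph.edist_triangle
      _ ≤ (G ⊔ SimpleGraph.edge a b).edist x y + ((G ⊔ SimpleGraph.edge a b).edist z w + 1) :=
          add_le_add le_rfl (edist_le_add_one hyz w)
      _ ≤ G.edist x y + (G.edist z w + 1) :=
          add_le_add (SimpleGraph.edist_anti hle)
            (add_le_add (SimpleGraph.edist_anti hle) le_rfl)
      _ = G.edist x y + 1 + G.edist z w := by ring
  refine le_antisymm (le_min (SimpleGraph.edist_anti hle)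
    (le_min (hvia a b hadj) (hvia b a hadj.symm))) ?_
  · refine le_edist_of_lipschitz (φ := fun x => min (G.edist x w)
      (min (G.edist x a + 1 + G.edist b w) (G.edist x b + 1 + G.edist a w))) (by simp) ?_ x
    intro x y hxy
    have hba : ¬G.Reachable b a := fun h => hab h.symm
    rcases hxy with hxy | hxy
    · simp only [min_add]
      have h3 : ∀ z, G.edist x z + 1 ≤ G.edist y z + 1 + 1 := fun z =>
        add_le_add (edist_le_add_one hxy z) le_rfl
      refine min_le_min (edist_le_add_one hxy w) (min_le_min ?_ ?_)
      · refine (add_le_add (h3 a) le_rfl).trans (le_of_eq (by ring))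
      · refine (add_le_add (h3 b) le_rfl).trans (le_of_eq (by ring))
    · rcases (SimpleGraph.edge_adj _ _ _ _).1 hxy |>.1 with ⟨rfl, rfl⟩ | ⟨rfl, rfl⟩
      · simp only [SimpleGraph.edist_self, zero_add,
          SimpleGraph.edist_eq_top_of_not_reachable hab,
          SimpleGraph.edist_eq_top_of_not_reachable hba, top_add, min_add, le_min_iff]
        refine ⟨?_, le_top, ?_⟩
        · exact (min_le_right _ _).trans ((min_le_left _ _).trans (le_of_eq (add_comm _ _)))
        · refine (min_le_left _ _).trans ?_
          rw [add_comm, ← add_assoc]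
          exact le_add_self
      · simp only [SimpleGraph.edist_self, zero_add,
          SimpleGraph.edist_eq_top_of_not_reachable hab,
          SimpleGraph.edist_eq_top_of_not_reachable hba, top_add, min_add, le_min_iff]
        refine ⟨?_, ?_, le_top⟩
        · exact (min_le_right _ _).trans ((min_le_right _ _).trans (le_of_eq (add_comm _ _)))
        · refine (min_le_left _ _).trans ?_
          rw [add_comm, ← add_assoc]
          exact le_add_self

lemma edist_sup_edge_of_reachable {G : SimpleGraph V} {a b : V} (hab : ¬G.Reachable a b) {x w : V}
    (h : G.Reachable x w) : (G ⊔ SimpleGraph.edge a b).edist x w = G.edist x w := by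
  rw [edist_sup_edge hab]
  have h1 : G.edist x a + 1 + G.edist b w = ⊤ := by
    by_cases hx : G.Reachable x a
    · rw [SimpleGraph.edist_eq_top_of_not_reachable (u := b) (v := w)
        fun hb => hab ((hx.symm.trans h).trans hb.symm)]
      simp
    · simp [SimpleGraph.edist_eq_top_of_not_reachable hx]
  have h2 : G.edist x b + 1 + G.edist a w = ⊤ := by
    by_cases hx : G.Reachable x b
    · rw [SimpleGraph.edist_eq_top_of_not_reachable (u := a) (v := w)
        fun ha => hab ((ha.trans h.symm).trans hx)]
      simp
    · simp [SimpleGraph.edist_eq_top_of_not_reachable hx]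
  simp [h1, h2]

lemma edist_sup_edge_of_reachable_ends {G : SimpleGraph V} {a b : V} (hab : ¬G.Reachable a b)
    {x w : V} (hx : G.Reachable x a) (hw : G.Reachable b w) :
    (G ⊔ SimpleGraph.edge a b).edist x w = G.edist x a + 1 + G.edist b w := by
  rw [edist_sup_edge hab, SimpleGraph.edist_eq_top_of_not_reachable (u := x) (v := w)
    fun h => hab ((hx.symm.trans h).trans hw.symm),
    SimpleGraph.edist_eq_top_of_not_reachable (u := x) (v := b) fun h => hab (hx.symm.trans h)]
  simp

lemma exists_edist_sup_edge_ne {G : SimpleGraph V} {R : Finset V}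
    (hR : ∀ u, ∃ w ∈ R, G.Reachable u w) {a b : V} (hab : ¬G.Reachable a b) {u v : V}
    (hu : G.Reachable u a) (hv : G.Reachable b v) :
    ∃ w ∈ R, (G ⊔ SimpleGraph.edge a b).edist u w ≠ (G ⊔ SimpleGraph.edge a b).edist v w := by
  obtain ⟨w, hwR, hw⟩ := hR u
  obtain ⟨z, hzR, hz⟩ := hR v
  by_contra! hcon
  have h1 := hcon w hwR
  have h2 := hcon z hzR
  have haw := hu.symm.trans hw
  have hbz := hv.trans hz
  rw [edist_sup_edge_of_reachable hab hw, SimpleGraph.edist_comm (u := v),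
    edist_sup_edge_of_reachable_ends hab haw.symm hv] at h1
  rw [edist_sup_edge_of_reachable hab hz, edist_sup_edge_of_reachable_ends hab hu hbz] at h2
  have t1 := SimpleGraph.edist_triangle (G := G) (u := u) (v := a) (w := w)
  have t2 := SimpleGraph.edist_triangle (G := G) (u := v) (v := b) (w := z)
  rw [SimpleGraph.edist_comm (u := w)] at h1
  rw [SimpleGraph.edist_comm (u := v) (v := b)] at t2
  obtain ⟨k1, e1⟩ := ENat.ne_top_iff_exists.1 (SimpleGraph.edist_ne_top_iff_reachable.2 hw)
  obtain ⟨k2, e2⟩ := ENat.ne_top_iff_exists.1 (SimpleGraph.edist_ne_top_iff_reachable.2 hz)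
  obtain ⟨k3, e3⟩ := ENat.ne_top_iff_exists.1 (SimpleGraph.edist_ne_top_iff_reachable.2 hu)
  obtain ⟨k4, e4⟩ := ENat.ne_top_iff_exists.1 (SimpleGraph.edist_ne_top_iff_reachable.2 hv)
  obtain ⟨k5, e5⟩ := ENat.ne_top_iff_exists.1 (SimpleGraph.edist_ne_top_iff_reachable.2 haw)
  obtain ⟨k6, e6⟩ := ENat.ne_top_iff_exists.1 (SimpleGraph.edist_ne_top_iff_reachable.2 hbz)
  rw [← e1, ← e4, ← e5] at h1
  rw [← e2, ← e3, ← e6] at h2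
  rw [← e1, ← e3, ← e5] at t1
  rw [← e2, ← e4, ← e6] at t2
  norm_cast at h1 h2 t1 t2
  omega

/-- Adding a bridge keeps strongly resolving sets strongly resolving. -/
lemma StrongResolves.sup_edge {G : SimpleGraph V} {R : Finset V} (h : StrongResolves G R) {a b : V}
    (hab : ¬G.Reachable a b) : StrongResolves (G ⊔ SimpleGraph.edge a b) R := by
  refine ⟨fun u => ?_, fun u v huv hr => ?_⟩
  · obtain ⟨w, hw, huw⟩ := h.1 u
    exact ⟨w, hw, huw.mono le_sup_left⟩
  by_cases hG : G.Reachable u v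
  · obtain ⟨w, hw, hne⟩ := h.2 u v huv hG
    have hu := reachable_of_edist_ne hG hne
    refine ⟨w, hw, ?_⟩
    rwa [edist_sup_edge_of_reachable hab hu, edist_sup_edge_of_reachable hab (hG.symm.trans hu)]
  · rw [← SimpleGraph.edist_ne_top_iff_reachable, edist_sup_edge hab,
      SimpleGraph.edist_eq_top_of_not_reachable hG, min_eq_right le_top, Ne, min_eq_top] at hr
    have hr' : (G.Reachable u a ∧ G.Reachable b v) ∨ (G.Reachable u b ∧ G.Reachable a v) := by
      simp only [← SimpleGraph.edist_ne_top_iff_reachable, ne_eq]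
      by_contra! hcon
      apply hr
      constructor
      · by_cases h1 : G.edist u a = ⊤
        · simp [h1]
        · simp [hcon.1 h1]
      · by_cases h1 : G.edist u b = ⊤
        · simp [h1]
        · simp [hcon.2 h1]
    rcases hr' with ⟨h1, h2⟩ | ⟨h1, h2⟩
    · exact exists_edist_sup_edge_ne h.1 hab h1 h2
    · obtain ⟨w, hw, hne⟩ := exists_edist_sup_edge_ne h.1 hab h2.symm h1.symm
      exact ⟨w, hw, hne.symm⟩

lemma StrongResolves.erase_sup_edge {G : SimpleGraph V} {R : Finset V} (h : StrongResolves G R)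
    {a b : V} (hne : a ≠ b) (ha : ∀ x, ¬G.Adj a x) (hb : ∀ x, ¬G.Adj b x) :
    StrongResolves (G ⊔ SimpleGraph.edge a b) (R.erase b) := by
  have hab : ¬G.Reachable a b := fun hr => hne (eq_of_reachable_of_isolated ha hr).symm
  have haR : a ∈ R.erase b := Finset.mem_erase.2 ⟨hne, h.mem_of_isolated ha⟩
  have hadj : (G ⊔ SimpleGraph.edge a b).Adj a b := by simp [SimpleGraph.edge_adj, hne]
  have hcomp : ∀ x, (G ⊔ SimpleGraph.edge a b).Reachable x b → x = a ∨ x = b := by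
    intro x hx
    refine reachable_induction (P := fun x => x = a ∨ x = b) (Or.inr rfl) ?_ hx.symm
    rintro x y hx (hxy | hxy)
    · rcases hx with rfl | rfl
      · exact absurd hxy (ha y)
      · exact absurd hxy (hb y)
    · rcases ((SimpleGraph.edge_adj _ _ _ _).1 hxy).1 with h | h
      · exact Or.inr h.2
      · exact Or.inl h.2
  have h' := h.sup_edge hab
  refine ⟨fun u => ?_, fun u v huv hr => ?_⟩
  · obtain ⟨w, hw, huw⟩ := h'.1 u
    by_cases hwb : w = b
    · subst hwb
      exact ⟨a, haR, huw.trans hadj.symm.reachable⟩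
    · exact ⟨w, Finset.mem_erase.2 ⟨hwb, hw⟩, huw⟩
  · obtain ⟨w, hw, hd⟩ := h'.2 u v huv hr
    by_cases hwb : w = b
    · subst hwb
      have hu := reachable_of_edist_ne hr hd
      refine ⟨a, haR, ?_⟩
      rcases hcomp u hu with rfl | rfl <;> rcases hcomp v (hr.symm.trans hu) with rfl | rfl
      · exact absurd rfl huv
      · rw [SimpleGraph.edist_self]
        exact (SimpleGraph.edist_pos_of_ne huv.symm).ne
      · rw [SimpleGraph.edist_self]
        exact (SimpleGraph.edist_pos_of_ne huv).ne'
      · exact absurd rfl huv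
    · exact ⟨w, Finset.mem_erase.2 ⟨hwb, hw⟩, hd⟩

/-- The least size of a strongly resolving set. -/
def strongDim (G : SimpleGraph V) : ℕ := sInf {k | ∃ R : Finset V, R.card = k ∧ StrongResolves G R}

lemma StrongResolves.strongDim_le {G : SimpleGraph V} {R : Finset V} (h : StrongResolves G R) :
    strongDim G ≤ R.card := Nat.sInf_le ⟨R, rfl, h⟩

variable [Fintype V]

lemma strongResolves_univ (G : SimpleGraph V) : StrongResolves G Finset.univ :=
  ⟨fun u => ⟨u, Finset.mem_univ u, SimpleGraph.Reachable.refl u⟩, fun u v huv _ =>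
    ⟨u, Finset.mem_univ u, by
      rw [SimpleGraph.edist_self]
      exact (SimpleGraph.edist_pos_of_ne huv.symm).ne⟩⟩

lemma exists_strongResolves_card_eq (G : SimpleGraph V) :
    ∃ R : Finset V, R.card = strongDim G ∧ StrongResolves G R :=
  Nat.sInf_mem (s := {k | ∃ R : Finset V, R.card = k ∧ StrongResolves G R})
    ⟨_, Finset.univ, rfl, strongResolves_univ G⟩

lemma strongDim_sup_edge_le {G : SimpleGraph V} {a b : V} (hab : ¬G.Reachable a b) :
    strongDim (G ⊔ SimpleGraph.edge a b) ≤ strongDim G := by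
  obtain ⟨R, hcard, hR⟩ := exists_strongResolves_card_eq G
  exact hcard ▸ (hR.sup_edge hab).strongDim_le

lemma strongDim_sup_edge_add_one_le {G : SimpleGraph V} {a b : V} (hne : a ≠ b)
    (ha : ∀ x, ¬G.Adj a x) (hb : ∀ x, ¬G.Adj b x) :
    strongDim (G ⊔ SimpleGraph.edge a b) + 1 ≤ strongDim G := by
  obtain ⟨R, hcard, hR⟩ := exists_strongResolves_card_eq G
  have h1 := (hR.erase_sup_edge hne ha hb).strongDim_le
  have h2 := Finset.card_erase_add_one (hR.mem_of_isolated hb)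
  omega

lemma StrongResolves.compl_subset_of_keep {G : SimpleGraph V} {A R : Finset V}
    (h : StrongResolves (keep G A) R) : Aᶜ ⊆ R := fun u hu =>
  h.mem_of_isolated fun _ (hx : _ ∧ u ∈ A ∧ _) => Finset.mem_compl.1 hu hx.2.1

lemma StrongResolves.keep_union {G : SimpleGraph V} {A R : Finset V} (hA : Separated G A)
    (h : StrongResolves G R) : StrongResolves (keep G A) (R ∪ Aᶜ) := by
  refine ⟨fun u => ?_, fun u v huv hr => ?_⟩
  · by_cases hu : u ∈ A
    · obtain ⟨w, hw, huw⟩ := h.1 u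
      exact ⟨w, Finset.mem_union_left _ hw, (reachable_keep hA hu).2 huw⟩
    · exact ⟨u, Finset.mem_union_right _ (Finset.mem_compl.2 hu), SimpleGraph.Reachable.refl u⟩
  · by_cases hu : u ∈ A
    · have hv : v ∈ A := (hA.keep A).mem_of_reachable hu hr
      obtain ⟨w, hw, hd⟩ := h.2 u v huv ((reachable_keep hA hu).1 hr)
      exact ⟨w, Finset.mem_union_left _ hw, by rwa [edist_keep hA hu, edist_keep hA hv]⟩
    · exact absurd (eq_of_reachable_of_isolated (fun x (hx : _ ∧ u ∈ A ∧ _) => hu hx.2.1) hr).symm huv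

lemma StrongResolves.inter {G : SimpleGraph V} {A R S : Finset V} (hA : Separated G A)
    (hR : StrongResolves (keep G A) R) (hS : StrongResolves (keep G Aᶜ) S) :
    StrongResolves G (R ∩ S) := by
  have key : ∀ (B : Finset V) (T : Finset V), Separated G B → StrongResolves (keep G B) T →
      (∀ u ∈ B, ∃ w ∈ T ∩ B, G.Reachable u w) ∧ ∀ u ∈ B, ∀ v, u ≠ v → G.Reachable u v →
        ∃ w ∈ T ∩ B, G.edist u w ≠ G.edist v w := by
    intro B T hB hT
    refine ⟨fun u hu => ?_, fun u hu v huv hr => ?_⟩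
    · obtain ⟨w, hw, huw⟩ := hT.1 u
      rw [reachable_keep hB hu] at huw
      exact ⟨w, Finset.mem_inter.2 ⟨hw, hB.mem_of_reachable hu huw⟩, huw⟩
    · obtain ⟨w, hw, hd⟩ := hT.2 u v huv ((reachable_keep hB hu).2 hr)
      rw [edist_keep hB hu, edist_keep hB (hB.mem_of_reachable hu hr)] at hd
      exact ⟨w, Finset.mem_inter.2 ⟨hw, hB.mem_of_reachable hu (reachable_of_edist_ne hr hd)⟩, hd⟩
  have h1 : R ∩ A ⊆ R ∩ S := by
    have := hS.compl_subset_of_keep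
    rw [compl_compl] at this
    exact Finset.inter_subset_inter_left this
  have h2 : S ∩ Aᶜ ⊆ R ∩ S := by
    rw [Finset.inter_comm R]
    exact Finset.inter_subset_inter_left hR.compl_subset_of_keep
  have kA := key A R hA hR
  have kB := key Aᶜ S hA.compl hS
  refine ⟨fun u => ?_, fun u v huv hr => ?_⟩
  · by_cases hu : u ∈ A
    · obtain ⟨w, hw, h⟩ := kA.1 u hu
      exact ⟨w, h1 hw, h⟩
    · obtain ⟨w, hw, h⟩ := kB.1 u (Finset.mem_compl.2 hu)
      exact ⟨w, h2 hw, h⟩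
  · by_cases hu : u ∈ A
    · obtain ⟨w, hw, h⟩ := kA.2 u hu v huv hr
      exact ⟨w, h1 hw, h⟩
    · obtain ⟨w, hw, h⟩ := kB.2 u (Finset.mem_compl.2 hu) v huv hr
      exact ⟨w, h2 hw, h⟩

lemma strongDim_keep_add_strongDim_keep {G : SimpleGraph V} {A : Finset V} (hA : Separated G A) :
    strongDim (keep G A) + strongDim (keep G Aᶜ) = Fintype.card V + strongDim G := by
  refine le_antisymm ?_ ?_
  · obtain ⟨R, hcard, hR⟩ := exists_strongResolves_card_eq G
    have h1 := (hR.keep_union hA).strongDim_le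
    have h2 := (hR.keep_union hA.compl).strongDim_le
    rw [compl_compl] at h2
    have h3 := Finset.card_union_add_card_inter (R ∪ Aᶜ) (R ∪ A)
    have h4 : (R ∪ Aᶜ) ∪ (R ∪ A) = Finset.univ := by ext x; simp; tauto
    have h5 : (R ∪ Aᶜ) ∩ (R ∪ A) = R := by ext x; simp; tauto
    rw [h4, h5, Finset.card_univ] at h3
    omega
  · obtain ⟨R, hcard, hR⟩ := exists_strongResolves_card_eq (keep G A)
    obtain ⟨S, hcard', hS⟩ := exists_strongResolves_card_eq (keep G Aᶜ)
    have h1 := (StrongResolves.inter hA hR hS).strongDim_le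
    have h3 := Finset.card_union_add_card_inter R S
    have h4 : R ∪ S = Finset.univ := by
      have hs := hS.compl_subset_of_keep
      rw [compl_compl] at hs
      refine Finset.eq_univ_of_forall fun x => ?_
      by_cases hx : x ∈ A
      · exact Finset.mem_union_right _ (hs hx)
      · exact Finset.mem_union_left _ (hR.compl_subset_of_keep (Finset.mem_compl.2 hx))
    rw [h4, Finset.card_univ] at h3
    omega

/-- The number of vertices saved by an optimal strongly resolving set, with a minus sign. -/
def strongDefect (G : SimpleGraph V) : ℝ := strongDim G - Fintype.card V

lemma componentAdditive_strongDefect : ComponentAdditive (strongDefect (V := V)) where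
  add G A hA := by
    have : (strongDim (keep G A) : ℝ) + strongDim (keep G Aᶜ) = Fintype.card V + strongDim G := by
      exact_mod_cast strongDim_keep_add_strongDim_keep hA
    unfold strongDefect
    linarith
  bound G A := by
    obtain ⟨R, hcard, hR⟩ := exists_strongResolves_card_eq (keep G A)
    have h1 := Finset.card_le_card hR.compl_subset_of_keep
    have h2 := Finset.card_le_univ R
    have h3 := Finset.card_add_card_compl A
    rw [hcard] at h1 h2
    have h4 : (Fintype.card V : ℝ) ≤ strongDim (keep G A) + A.card := by
      exact_mod_cast (by omega : Fintype.card V ≤ strongDim (keep G A) + A.card)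
    have h5 : (strongDim (keep G A) : ℝ) ≤ Fintype.card V := by exact_mod_cast h2
    have h6 : (0 : ℝ) ≤ A.card := Nat.cast_nonneg _
    exact abs_le.2 ⟨by unfold strongDefect; linarith, by unfold strongDefect; linarith⟩

lemma StrongResolves.resolves {G : SimpleGraph V} {R : Finset V} (h : StrongResolves G R) :
    Resolves G (R : Set V) := by
  intro u v huv
  by_cases hr : G.Reachable u v
  · obtain ⟨w, hw, hd⟩ := h.2 u v huv hr
    exact ⟨w, hw, hd⟩
  · obtain ⟨w, hw, hd⟩ := h.1 u
    refine ⟨w, hw, ?_⟩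
    rw [SimpleGraph.edist_eq_top_of_not_reachable (u := v) fun hv => hr (hd.trans hv.symm)]
    exact SimpleGraph.edist_ne_top_iff_reachable.2 hd

lemma metricDim_le_strongDim (hV : 2 ≤ Fintype.card V) (G : SimpleGraph V) :
    metricDim G ≤ strongDim G := by
  obtain ⟨R, hcard, hR⟩ := exists_strongResolves_card_eq G
  rw [metricDim, if_neg (by rw [Nat.card_eq_fintype_card]; omega), ← hcard]
  exact Nat.sInf_le ⟨R, Set.ncard_coe_finset R, hR.resolves⟩

lemma strongDim_le_metricDim_add_one (hV : 2 ≤ Fintype.card V) (G : SimpleGraph V) :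
    strongDim G ≤ metricDim G + 1 := by
  rw [metricDim, if_neg (by rw [Nat.card_eq_fintype_card]; omega)]
  obtain ⟨R, hcard, hR⟩ := Nat.sInf_mem (s := {m : ℕ | ∃ R : Set V, R.ncard = m ∧ Resolves G R})
    ⟨_, _, rfl, (strongResolves_univ G).resolves⟩
  rw [← hcard, Set.ncard_eq_toFinset_card']
  by_cases hcov : ∀ u, ∃ w ∈ R, G.Reachable u w
  · have : StrongResolves G R.toFinset := by
      refine ⟨fun u => ?_, fun u v huv _ => ?_⟩
      · simpa using hcov u
      · simpa using hR u v huv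
    exact this.strongDim_le.trans (Nat.le_succ _)
  · push Not at hcov
    obtain ⟨z, hz⟩ := hcov
    have : StrongResolves G (insert z R.toFinset) := by
      refine ⟨fun u => ?_, fun u v huv _ => ?_⟩
      · by_cases huz : u = z
        · exact ⟨z, by simp, huz ▸ SimpleGraph.Reachable.refl u⟩
        · obtain ⟨w, hw, hd⟩ := hR u z huz
          rw [SimpleGraph.edist_eq_top_of_not_reachable (hz w hw)] at hd
          exact ⟨w, by simp [hw], SimpleGraph.edist_ne_top_iff_reachable.1 hd⟩
      · obtain ⟨w, hw, hd⟩ := hR u v huv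
        exact ⟨w, by simp [hw], hd⟩
    exact this.strongDim_le.trans (Finset.card_insert_le _ _)

end Resolving

section VarianceLowerBound

variable {V : Type*}

lemma cfgGraph_setBit_true (ω : Sym2 V → Bool) (a b : V) :
    cfgGraph (setBit ω s(a, b) true) =
      cfgGraph (setBit ω s(a, b) false) ⊔ SimpleGraph.edge a b := by
  ext x y
  rw [SimpleGraph.sup_adj, cfgGraph_adj, cfgGraph_adj, SimpleGraph.adj_edge]
  by_cases h : s(x, y) = s(a, b)
  · simp [h, setBit_self]
  · simp [setBit_of_ne _ h, Ne.symm h]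

variable [Fintype V] {p m : ℝ}

/-- The edges other than `ab` that meet `a` or `b`. -/
def otherEdges (a b : V) : Finset (Sym2 V) :=
  Finset.univ.filter fun e => (a ∈ e ∨ b ∈ e) ∧ e ≠ s(a, b)

lemma card_otherEdges_le (a b : V) : (otherEdges a b).card ≤ 2 * Fintype.card V := by
  have h : otherEdges a b ⊆
      Finset.univ.image (fun x => s(a, x)) ∪ Finset.univ.image (fun x => s(b, x)) := by
    intro e he
    rw [otherEdges, Finset.mem_filter] at he
    rcases he.2.1 with ⟨x, rfl⟩ | ⟨x, rfl⟩ <;> simp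
  refine (Finset.card_le_card h).trans ((Finset.card_union_le _ _).trans ?_)
  rw [two_mul]
  exact add_le_add Finset.card_image_le Finset.card_image_le

lemma not_adj_of_otherEdges {ω : Sym2 V → Bool} {a b : V}
    (h : ∀ e ∈ otherEdges a b, ω e = false) {z : V} (hz : z = a ∨ z = b) (x : V) :
    ¬(cfgGraph (setBit ω s(a, b) false)).Adj z x := by
  rw [cfgGraph_adj]
  rintro ⟨h1, -⟩
  by_cases he : s(z, x) = s(a, b)
  · rw [he, setBit_self] at h1
    exact Bool.false_ne_true h1
  · rw [setBit_of_ne _ he, h s(z, x)] at h1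
    · exact Bool.false_ne_true h1
    · rw [otherEdges, Finset.mem_filter]
      refine ⟨Finset.mem_univ _, ?_, he⟩
      rcases hz with rfl | rfl <;> simp

lemma flipDiff_strongDefect_le (a b : V) (ω : Sym2 V → Bool) :
    flipDiff s(a, b) (fun ω => strongDefect (cfgGraph ω)) ω ≤
      2 * (if b ∈ compOf (cfgGraph ω) a then ((compOf (cfgGraph ω) a).card : ℝ) else 0) -
        if a ≠ b then ∏ e ∈ otherEdges a b, (if ω e = true then (0 : ℝ) else 1) else 0 := by
  set G₀ := cfgGraph (setBit ω s(a, b) false) with hG₀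
  have hflip : flipDiff s(a, b) (fun ω => strongDefect (cfgGraph ω)) ω =
      strongDefect (G₀ ⊔ SimpleGraph.edge a b) - strongDefect G₀ := by
    rw [flipDiff, cfgGraph_setBit_true]
  have hprod : ∀ e, (0 : ℝ) ≤ if ω e = true then (0 : ℝ) else 1 := fun e =>
    ite_nonneg le_rfl zero_le_one
  have hprod0 : (0 : ℝ) ≤ ∏ e ∈ otherEdges a b, (if ω e = true then (0 : ℝ) else 1) :=
    Finset.prod_nonneg fun e _ => hprod e
  have hprod_ne : ∏ e ∈ otherEdges a b, (if ω e = true then (0 : ℝ) else 1) ≠ 0 →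
      ∀ e ∈ otherEdges a b, ω e = false := by
    intro h e he
    by_contra hω
    exact h (Finset.prod_eq_zero he (by simp [hω]))
  have hcard : (0 : ℝ) ≤ if b ∈ compOf (cfgGraph ω) a then ((compOf (cfgGraph ω) a).card : ℝ)
      else 0 := ite_nonneg (Nat.cast_nonneg _) le_rfl
  have hle : G₀ ≤ cfgGraph ω := cfgGraph_setBit_false_le ω s(a, b)
  rw [hflip]
  by_cases hr : G₀.Reachable a b
  · have hb : b ∈ compOf (cfgGraph ω) a := mem_compOf.2 (hr.mono hle)
    have hzero : (if a ≠ b then ∏ e ∈ otherEdges a b, (if ω e = true then (0 : ℝ) else 1)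
        else 0) = 0 := by
      by_cases hab : a = b
      · simp [hab]
      · rw [if_pos hab]
        by_contra hne
        exact hab (eq_of_reachable_of_isolated
          (not_adj_of_otherEdges (hprod_ne hne) (Or.inl rfl)) hr).symm
    rw [hzero, if_pos hb, sub_zero]
    have hK : edgeHull a b ω ⊆ compOf (cfgGraph ω) a := by
      refine Finset.union_subset (compOf_mono hle a) ?_
      rw [← compOf_eq_of_mem hb]
      exact compOf_mono hle b
    have hK' : ((edgeHull a b ω).card : ℝ) ≤ (compOf (cfgGraph ω) a).card := by
      exact_mod_cast Finset.card_le_card hK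
    have hY := componentAdditive_strongDefect (V := V)
    have h1 := hY.add _ _ (separated_edgeHull ω a b true)
    have h0 := hY.add _ _ (separated_edgeHull ω a b false)
    have hc := keep_setBit_compl_edgeHull ω a b Finset.univ true
    simp only [Finset.univ_inter] at hc
    rw [hc] at h1
    have b1 := abs_le.1 (hY.bound (cfgGraph (setBit ω s(a, b) true)) (edgeHull a b ω))
    have b0 := abs_le.1 (hY.bound (cfgGraph (setBit ω s(a, b) false)) (edgeHull a b ω))
    rw [← cfgGraph_setBit_true, hG₀, h1, h0]
    linarith
  · have hne : a ≠ b := fun h => hr (h ▸ SimpleGraph.Reachable.refl a)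
    rw [if_pos hne]
    by_cases hiso : ∀ e ∈ otherEdges a b, ω e = false
    · have h1 : (strongDim (G₀ ⊔ SimpleGraph.edge a b) : ℝ) + 1 ≤ strongDim G₀ := by
        exact_mod_cast strongDim_sup_edge_add_one_le hne
          (not_adj_of_otherEdges hiso (Or.inl rfl)) (not_adj_of_otherEdges hiso (Or.inr rfl))
      have h2 : ∏ e ∈ otherEdges a b, (if ω e = true then (0 : ℝ) else 1) = 1 :=
        Finset.prod_eq_one fun e he => by simp [hiso e he]
      rw [h2]
      unfold strongDefect
      linarith
    · have h1 : (strongDim (G₀ ⊔ SimpleGraph.edge a b) : ℝ) ≤ strongDim G₀ := by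
        exact_mod_cast strongDim_sup_edge_le hr
      have h2 : ∏ e ∈ otherEdges a b, (if ω e = true then (0 : ℝ) else 1) = 0 := by
        by_contra h
        exact hiso (hprod_ne h)
      rw [h2]
      unfold strongDefect
      linarith

lemma bernExp_flipDiff_strongDefect_le (hp0 : 0 ≤ p) (hp1 : p ≤ 1) (a b : V) :
    bernExp p (flipDiff s(a, b) fun ω => strongDefect (cfgGraph ω)) ≤
      2 * bernExp p (fun ω => if b ∈ compOf (cfgGraph ω) a then
        ((compOf (cfgGraph ω) a).card : ℝ) else 0) -
      if a ≠ b then (1 - p) ^ (2 * Fintype.card V) else 0 := by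
  refine (bernExp_mono hp0 hp1 (flipDiff_strongDefect_le a b)).trans ?_
  rw [bernExp_sub, bernExp_mul_left]
  refine sub_le_sub_left ?_ _
  by_cases hab : a = b
  · simp [hab, bernExp_const]
  · simp only [ne_eq, hab, not_false_eq_true, if_true]
    rw [bernExp_finset_prod p _ fun t => if t = true then (0 : ℝ) else 1]
    simp only [if_true, mul_zero, Bool.false_eq_true, if_false, mul_one, zero_add]
    exact pow_le_pow_of_le_one (by linarith) (by linarith) (card_otherEdges_le a b)

lemma sum_bernExp_flipDiff_strongDefect_le (hp0 : 0 ≤ p) (hp1 : p ≤ 1)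
    (hm : FourthMomentLE V p m) :
    ∑ e, bernExp p (flipDiff e fun ω : Sym2 V → Bool => strongDefect (cfgGraph ω)) ≤
      2 * (Fintype.card V * m) -
        (Fintype.card V).choose 2 * (1 - p) ^ (2 * Fintype.card V) := by
  set g : V × V → ℝ := fun x => bernExp p fun ω : Sym2 V → Bool =>
    if x.2 ∈ compOf (cfgGraph ω) x.1 then ((compOf (cfgGraph ω) x.1).card : ℝ) else 0 with hg
  have hg0 : ∀ x, 0 ≤ g x := fun x => bernExp_nonneg hp0 hp1 fun ω =>
    ite_nonneg (Nat.cast_nonneg _) le_rfl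
  have hterm : ∀ e : Sym2 V, bernExp p (flipDiff e fun ω => strongDefect (cfgGraph ω)) ≤
      2 * g (Quot.out e) - if ¬e.IsDiag then (1 - p) ^ (2 * Fintype.card V) else 0 := by
    intro e
    have he : e = s((Quot.out e).1, (Quot.out e).2) := (Quot.out_eq e).symm
    have h := bernExp_flipDiff_strongDefect_le hp0 hp1 (Quot.out e).1 (Quot.out e).2
    rw [← he] at h
    have hd : e.IsDiag ↔ (Quot.out e).1 = (Quot.out e).2 := by
      conv_lhs => rw [he]
      exact Sym2.mk_isDiag_iff
    simpa only [hd] using h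
  refine (Finset.sum_le_sum fun e _ => hterm e).trans ?_
  rw [Finset.sum_sub_distrib, ← Finset.mul_sum]
  have h1 : ∑ e : Sym2 V, g (Quot.out e) ≤ Fintype.card V * m := by
    have hinj : Function.Injective (Quot.out : Sym2 V → V × V) := fun x y h => by
      rw [← Quot.out_eq x, ← Quot.out_eq y, h]
    calc ∑ e : Sym2 V, g (Quot.out e) = ∑ x ∈ Finset.univ.image (Quot.out : Sym2 V → V × V), g x :=
          (Finset.sum_image fun x _ y _ h => hinj h).symm
      _ ≤ ∑ x, g x := Finset.sum_le_univ_sum_of_nonneg hg0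
      _ = ∑ a, bernExp p (fun ω : Sym2 V → Bool => ((compOf (cfgGraph ω) a).card : ℝ) ^ 2) := by
          rw [Fintype.sum_prod_type]
          refine Finset.sum_congr rfl fun a _ => ?_
          rw [hg, ← bernExp_sum]
          congr 1
          ext ω
          change (∑ b, if b ∈ compOf (cfgGraph ω) a then
            ((compOf (cfgGraph ω) a).card : ℝ) else 0) = _
          rw [← Finset.sum_filter, Finset.sum_const, Finset.filter_univ_mem, nsmul_eq_mul, sq]
      _ ≤ ∑ _a : V, m := Finset.sum_le_sum fun a _ => hm.pow hp0 hp1 (by norm_num) a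
      _ = Fintype.card V * m := by rw [Finset.sum_const, nsmul_eq_mul, Finset.card_univ]
  have h2 : ∑ e : Sym2 V, (if ¬e.IsDiag then (1 - p) ^ (2 * Fintype.card V) else 0) =
      (Fintype.card V).choose 2 * (1 - p) ^ (2 * Fintype.card V) := by
    rw [← Finset.sum_filter, Finset.sum_const, nsmul_eq_mul, ← Sym2.card_subtype_not_diag,
      Fintype.card_subtype]
  rw [h2]
  linarith

lemma card_sym2_le_sq (n : ℕ) : (Fintype.card (Sym2 (Fin n)) : ℝ) ≤ (n : ℝ) ^ 2 := by
  rw [Sym2.card, Fintype.card_fin]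
  norm_cast
  rw [Nat.choose_two_right]
  refine Nat.div_le_of_le_mul ?_
  rcases n with _ | n
  · simp
  · simp only [Nat.add_sub_cancel]
    nlinarith

/-- The variance of the defect grows linearly. -/
lemma exists_mul_le_bernVar_strongDefect {c : ℝ} (hc0 : 0 < c) (hc1 : c < 1) :
    ∃ κ : ℝ, 0 < κ ∧ ∃ N : ℕ, ∀ n : ℕ, N ≤ n →
      κ * n ≤ bernVar (c / n) fun ω : Sym2 (Fin n) → Bool => strongDefect (cfgGraph ω) := by
  obtain ⟨m, hm1, hm⟩ := exists_fourthMomentLE hc1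
  set q := Real.exp (-(4 * c)) with hq
  have hq0 : 0 < q := Real.exp_pos _
  obtain ⟨N, hN⟩ := exists_nat_ge (2 + (2 + 16 * m) / q)
  refine ⟨c * q ^ 2 / 256, by positivity, N, fun n hn => ?_⟩
  have hnN : 2 + (2 + 16 * m) / q ≤ n := hN.trans (by exact_mod_cast hn)
  have hn2 : (2 : ℝ) ≤ n := by
    have : 0 ≤ (2 + 16 * m) / q := by positivity
    linarith
  have hnq : 2 * q + (2 + 16 * m) ≤ n * q := by
    have := mul_le_mul_of_nonneg_right hnN hq0.le
    rwa [add_mul, div_mul_cancel₀ _ hq0.ne'] at this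
  have hn0 : (0 : ℝ) < n := by linarith
  set p := c / n with hp
  have hp0 : 0 < p := by positivity
  have hpn : p * n = c := div_mul_cancel₀ _ hn0.ne'
  have hp2 : p ≤ 1 / 2 := by
    rw [hp, div_le_iff₀ hn0]
    linarith
  have hp1 : p ≤ 1 := by linarith
  have hm' := hm n p hp0.le hp1 hpn.le
  have hpow : q ≤ (1 - p) ^ (2 * n) := by
    have h1 : Real.exp (-(2 * p)) ≤ 1 - p := by
      have h2 : Real.exp (-(2 * p)) * Real.exp (2 * p) = 1 := by
        rw [← Real.exp_add]; simp
      have h3 := Real.add_one_le_exp (2 * p)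
      have h4 : 1 ≤ (1 - p) * Real.exp (2 * p) := by
        nlinarith [mul_le_mul_of_nonneg_left h3 (by linarith : (0 : ℝ) ≤ 1 - p)]
      exact le_of_mul_le_mul_right (h2.le.trans h4) (Real.exp_pos _)
    refine le_trans (le_of_eq ?_) (pow_le_pow_left₀ (Real.exp_pos _).le h1 (2 * n))
    rw [← Real.exp_nat_mul, hq]
    push_cast
    rw [← hpn]
    ring_nf
  have hsum := sum_bernExp_flipDiff_strongDefect_le hp0.le hp1 hm'
  rw [Fintype.card_fin, Nat.cast_choose_two] at hsum
  set S := ∑ e, bernExp p (flipDiff e fun ω : Sym2 (Fin n) → Bool => strongDefect (cfgGraph ω))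
  have hS : (n : ℝ) ^ 2 * q / 8 ≤ -S := by
    have h1 : (n : ℝ) * (n - 1) / 2 * q ≤ (n : ℝ) * (n - 1) / 2 * (1 - p) ^ (2 * n) :=
      mul_le_mul_of_nonneg_left hpow (by nlinarith)
    nlinarith
  have hvar := sq_sum_flipDiff_le_bernVar hp0.le hp1
    (fun ω : Sym2 (Fin n) → Bool => strongDefect (cfgGraph ω))
  set W := bernVar p fun ω : Sym2 (Fin n) → Bool => strongDefect (cfgGraph ω)
  have hW0 : 0 ≤ W := bernExp_nonneg hp0.le hp1 fun ω => sq_nonneg _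
  have h1 : p / 2 * ((n : ℝ) ^ 2 * q / 8) ≤ p * (1 - p) * -S := by
    refine mul_le_mul ?_ hS (by positivity) (mul_nonneg hp0.le (by linarith))
    nlinarith
  have h2 : (p / 2 * ((n : ℝ) ^ 2 * q / 8)) ^ 2 ≤ W * (p * (n : ℝ) ^ 2) := by
    calc (p / 2 * ((n : ℝ) ^ 2 * q / 8)) ^ 2 ≤ (p * (1 - p) * -S) ^ 2 :=
          pow_le_pow_left₀ (by positivity) h1 2
      _ = (p * (1 - p) * S) ^ 2 := by ring
      _ ≤ W * (p * Fintype.card (Sym2 (Fin n))) := hvar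
      _ ≤ W * (p * (n : ℝ) ^ 2) := mul_le_mul_of_nonneg_left
          (mul_le_mul_of_nonneg_left (card_sym2_le_sq n) hp0.le) hW0
  have h3 : (p / 2 * ((n : ℝ) ^ 2 * q / 8)) ^ 2 =
      (c * q ^ 2 / 256 * n) * (p * (n : ℝ) ^ 2) := by
    rw [← hpn]
    ring
  rw [h3] at h2
  exact le_of_mul_le_mul_right h2 (by positivity)

end VarianceLowerBound

section Transfer

variable {ι : Type*} [Fintype ι] {p : ℝ}

lemma sqrt_bernExp_add_sq_le (hp0 : 0 ≤ p) (hp1 : p ≤ 1) (f g : (ι → Bool) → ℝ) :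
    Real.sqrt (bernExp p fun ω => (f ω + g ω) ^ 2) ≤
      Real.sqrt (bernExp p fun ω => f ω ^ 2) + Real.sqrt (bernExp p fun ω => g ω ^ 2) := by
  have hf : 0 ≤ bernExp p fun ω => f ω ^ 2 := bernExp_nonneg hp0 hp1 fun ω => sq_nonneg _
  have hg : 0 ≤ bernExp p fun ω => g ω ^ 2 := bernExp_nonneg hp0 hp1 fun ω => sq_nonneg _
  have hfg : bernExp p (fun ω => f ω * g ω) ≤
      Real.sqrt (bernExp p fun ω => f ω ^ 2) * Real.sqrt (bernExp p fun ω => g ω ^ 2) := by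
    rw [← Real.sqrt_mul hf]
    exact Real.le_sqrt_of_sq_le (bernExp_mul_sq_le hp0 hp1 f g)
  refine Real.sqrt_le_iff.2 ⟨add_nonneg (Real.sqrt_nonneg _) (Real.sqrt_nonneg _), ?_⟩
  have h : bernExp p (fun ω => (f ω + g ω) ^ 2) =
      bernExp p (fun ω => f ω ^ 2) + 2 * bernExp p (fun ω => f ω * g ω) +
        bernExp p (fun ω => g ω ^ 2) := by
    rw [← bernExp_mul_left, ← bernExp_add, ← bernExp_add]
    congr 1
    ext ω
    ring
  rw [h, add_sq, Real.sq_sqrt hf, Real.sq_sqrt hg]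
  linarith

lemma bernVar_le_one_of_abs_le_one (hp0 : 0 ≤ p) (hp1 : p ≤ 1) {f : (ι → Bool) → ℝ}
    (hf : ∀ ω, |f ω| ≤ 1) : bernVar p f ≤ 1 := by
  rw [bernVar_eq]
  have h := bernExp_mono hp0 hp1 (g := fun _ => 1) fun ω => (sq_le_one_iff_abs_le_one _).2 (hf ω)
  rw [bernExp_const] at h
  linarith [sq_nonneg (bernExp p f)]

/-- A perturbation by at most one changes the law of the standardized variable, tested against a
Lipschitz function, by at most a multiple of the inverse standard deviation. -/
lemma abs_bernExp_standardize_sub_le (hp0 : 0 ≤ p) (hp1 : p ≤ 1) {f g : (ι → Bool) → ℝ}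
    (hfg : ∀ ω, |f ω - g ω| ≤ 1) {σ : ℝ} (hσ : 0 < σ) (hvar : σ = Real.sqrt (bernVar p g))
    {h : ℝ → ℝ} {H' : ℝ} (hd : Differentiable ℝ h) (hH' : ∀ x, |deriv h x| ≤ H') :
    |bernExp p (fun ω => h ((f ω - bernExp p f) / Real.sqrt (bernVar p f))) -
      bernExp p (fun ω => h ((g ω - bernExp p g) / σ))| ≤ H' * (2 / σ) := by
  set τ := Real.sqrt (bernVar p f) with hτ
  have hτ0 : 0 ≤ τ := Real.sqrt_nonneg _
  set A : (ι → Bool) → ℝ := fun ω => f ω - bernExp p f with hA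
  set B : (ι → Bool) → ℝ := fun ω => g ω - bernExp p g with hB
  have hD1 : bernExp p (fun ω => (A ω - B ω) ^ 2) ≤ 1 := by
    refine le_trans (le_of_eq ?_) (bernVar_le_one_of_abs_le_one hp0 hp1 hfg)
    rw [bernVar, bernExp_sub]
    congr 1
    ext ω
    simp only [hA, hB]
    ring
  have hD : Real.sqrt (bernExp p fun ω => (A ω - B ω) ^ 2) ≤ 1 := Real.sqrt_le_one.2 hD1
  have hstd : |τ - σ| ≤ 1 := by
    have h1 := sqrt_bernExp_add_sq_le hp0 hp1 B fun ω => A ω - B ω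
    have h2 := sqrt_bernExp_add_sq_le hp0 hp1 A fun ω => B ω - A ω
    simp only [add_sub_cancel, sub_sq_comm (B _)] at h1 h2
    rw [abs_le, hτ, hvar, bernVar, bernVar]
    constructor <;> linarith
  have hAD : bernExp p (fun ω => |A ω - B ω|) ≤ 1 := (bernExp_abs_le_sqrt hp0 hp1 _).trans hD
  have hAτ : bernExp p (fun ω => |A ω|) ≤ τ := bernExp_abs_le_sqrt hp0 hp1 _
  have hH0 : 0 ≤ H' := (abs_nonneg _).trans (hH' 0)
  have hlip : ∀ x y, |h x - h y| ≤ H' * |x - y| := fun x y => by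
    have := convex_univ.norm_image_sub_le_of_norm_deriv_le (𝕜 := ℝ) (f := h) (C := H')
      (fun z _ => hd z) (fun z _ => hH' z) (Set.mem_univ y) (Set.mem_univ x)
    simpa [Real.norm_eq_abs] using this
  have hcoef : τ * |τ⁻¹ - σ⁻¹| ≤ 1 / σ := by
    rcases hτ0.eq_or_lt with h0 | h0
    · rw [← h0, zero_mul]
      positivity
    · rw [← abs_of_pos h0, ← abs_mul, abs_of_pos h0]
      have : τ * (τ⁻¹ - σ⁻¹) = -((τ - σ) / σ) := by
        field_simp
        ring
      rw [this, abs_neg, abs_div, abs_of_pos hσ]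
      exact div_le_div_of_nonneg_right hstd hσ.le
  have hpt : ∀ ω, |h (A ω / τ) - h (B ω / σ)| ≤
      H' * (|A ω - B ω| * σ⁻¹ + |A ω| * |τ⁻¹ - σ⁻¹|) := fun ω => by
    refine (hlip _ _).trans (mul_le_mul_of_nonneg_left ?_ hH0)
    have : A ω / τ - B ω / σ = (A ω - B ω) * σ⁻¹ + A ω * (τ⁻¹ - σ⁻¹) := by
      rw [div_eq_mul_inv, div_eq_mul_inv]
      ring
    rw [this]
    refine (abs_add_le _ _).trans (le_of_eq ?_)
    rw [abs_mul, abs_mul, abs_of_pos (inv_pos.2 hσ)]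
  rw [← bernExp_sub]
  refine (abs_bernExp_le hp0 hp1 _).trans ((bernExp_mono hp0 hp1 hpt).trans ?_)
  rw [bernExp_mul_left, bernExp_add, bernExp_mul_right, bernExp_mul_right]
  refine mul_le_mul_of_nonneg_left ?_ hH0
  have e1 : bernExp p (fun ω => |A ω - B ω|) * σ⁻¹ ≤ 1 * σ⁻¹ :=
    mul_le_mul_of_nonneg_right hAD (inv_nonneg.2 hσ.le)
  have e2 : bernExp p (fun ω => |A ω|) * |τ⁻¹ - σ⁻¹| ≤ 1 / σ :=
    (mul_le_mul_of_nonneg_right hAτ (abs_nonneg _)).trans hcoef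
  calc _ ≤ 1 * σ⁻¹ + 1 / σ := add_le_add e1 e2
    _ = 2 / σ := by ring

end Transfer

section ErdosRenyi

variable {n : ℕ}

lemma cfgGraph_eq_iff (ω : Sym2 (Fin n) → Bool) (G : SimpleGraph (Fin n)) :
    cfgGraph ω = G ↔ ∀ e : Sym2 (Fin n), ¬e.IsDiag → (ω e = true ↔ e ∈ G.edgeSet) := by
  constructor
  · rintro rfl e
    induction e with
    | _ x y =>
      intro he
      rw [SimpleGraph.mem_edgeSet, cfgGraph_adj]
      exact ⟨fun h => ⟨h, fun hxy => he (Sym2.mk_isDiag_iff.2 hxy)⟩, fun h => h.1⟩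
  · intro h
    ext x y
    rw [cfgGraph_adj]
    constructor
    · rintro ⟨h1, h2⟩
      exact (h s(x, y) fun hd => h2 (Sym2.mk_isDiag_iff.1 hd)).1 h1
    · intro h1
      exact ⟨(h s(x, y) fun hd => h1.ne (Sym2.mk_isDiag_iff.1 hd)).2 h1, h1.ne⟩

lemma bernExp_cfgGraph_eq (p : ℝ) (G : SimpleGraph (Fin n)) :
    bernExp p (fun ω => if cfgGraph ω = G then (1 : ℝ) else 0) = erWeight n p G := by
  have h1 : ∀ ω : Sym2 (Fin n) → Bool, (if cfgGraph ω = G then (1 : ℝ) else 0) =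
      ∏ e, if e.IsDiag ∨ (ω e = true ↔ e ∈ G.edgeSet) then 1 else 0 := by
    intro ω
    rw [Fintype.prod_ite_zero, Finset.prod_const_one, cfgGraph_eq_iff]
    simp only [or_iff_not_imp_left]
    congr
  simp_rw [h1]
  rw [bernExp_prod p fun (e : Sym2 (Fin n)) b =>
    if e.IsDiag ∨ (b = true ↔ e ∈ G.edgeSet) then (1 : ℝ) else 0]
  have h2 : ∀ e : Sym2 (Fin n),
      (p * (if e.IsDiag ∨ (true = true ↔ e ∈ G.edgeSet) then (1 : ℝ) else 0) +
        (1 - p) * if e.IsDiag ∨ (false = true ↔ e ∈ G.edgeSet) then 1 else 0) =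
      (if e ∈ G.edgeFinset then p else 1) *
        if e ∈ (Finset.univ.filter fun e : Sym2 (Fin n) => ¬e.IsDiag) \ G.edgeFinset
          then 1 - p else 1 := by
    intro e
    by_cases hd : e.IsDiag
    · have he : e ∉ G.edgeSet := fun h => G.not_isDiag_of_mem_edgeSet h hd
      simp [hd, he]
    · by_cases he : e ∈ G.edgeSet <;> simp [hd, he]
  rw [Finset.prod_congr rfl fun e _ => h2 e, Finset.prod_mul_distrib, Finset.prod_ite_mem,
    Finset.prod_ite_mem, Finset.univ_inter, Finset.univ_inter, Finset.prod_const,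
    Finset.prod_const, Finset.card_sdiff_of_subset, erWeight]
  · have h3 : (Finset.univ.filter fun e : Sym2 (Fin n) => ¬e.IsDiag).card = n.choose 2 := by
      rw [← Fintype.card_subtype, Sym2.card_subtype_not_diag, Fintype.card_fin]
    rw [h3, Nat.card_eq_fintype_card, SimpleGraph.edgeFinset_card]
  · intro e he
    rw [Finset.mem_filter]
    exact ⟨Finset.mem_univ _, G.not_isDiag_of_mem_edgeSet (SimpleGraph.mem_edgeFinset.1 he)⟩

/-- The Erdős–Rényi law is the image of the product Bernoulli law. -/
lemma erExp_eq_bernExp (p : ℝ) (F : SimpleGraph (Fin n) → ℝ) :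
    erExp n p F = bernExp p fun ω => F (cfgGraph ω) := by
  have h : ∀ ω : Sym2 (Fin n) → Bool, F (cfgGraph ω) =
      ∑ G, (if cfgGraph ω = G then (1 : ℝ) else 0) * F G := by
    intro ω
    simp
  rw [erExp, finsum_eq_sum_of_fintype]
  simp_rw [h]
  rw [bernExp_sum]
  refine Finset.sum_congr rfl fun G _ => ?_
  rw [bernExp_mul_right, bernExp_cfgGraph_eq]

lemma erVar_eq_bernVar (p : ℝ) (F : SimpleGraph (Fin n) → ℝ) :
    erVar n p F = bernVar p fun ω => F (cfgGraph ω) := by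
  rw [erVar, erExp_eq_bernExp, erExp_eq_bernExp, bernVar]

lemma bernVar_sub_const {ι : Type*} [Fintype ι] (p a : ℝ) (f : (ι → Bool) → ℝ) :
    bernVar p (fun ω => f ω - a) = bernVar p f := by
  unfold bernVar
  rw [bernExp_sub, bernExp_const]
  congr 1
  ext ω
  ring

/-- The nonasymptotic normal approximation for the metric dimension. -/
lemma abs_erExp_erNormβ_sub_gaussInt_le {p m σ H H' : ℝ} (hn : 2 ≤ n) (hp0 : 0 ≤ p) (hp1 : p ≤ 1)
    (hm : FourthMomentLE (Fin n) p m) (hσ : 0 < σ)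
    (hvar : σ ^ 2 = bernVar p fun ω : Sym2 (Fin n) → Bool => strongDefect (cfgGraph ω))
    {h : ℝ → ℝ} (hd : Differentiable ℝ h) (hH : ∀ x, |h x| ≤ H)
    (hH' : ∀ x, |deriv h x| ≤ H') :
    |erExp n p (fun G => h (erNormβ n p G)) - gaussInt h| ≤
      4 * H * Real.sqrt (p * Fintype.card (Sym2 (Fin n)) * (256 * m ^ 3)) / σ ^ 2 +
        (20 * H + 2 * H') * (n * (9 * m ^ 2)) / σ ^ 3 + H' * (2 / σ) := by
  set g : (Sym2 (Fin n) → Bool) → ℝ := fun ω => strongDefect (cfgGraph ω) with hg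
  set f : (Sym2 (Fin n) → Bool) → ℝ := fun ω => betaR (cfgGraph ω) - n with hf
  have hfg : ∀ ω, |f ω - g ω| ≤ 1 := fun ω => by
    have hV : 2 ≤ Fintype.card (Fin n) := by rwa [Fintype.card_fin]
    have h1 : (metricDim (cfgGraph ω) : ℝ) ≤ strongDim (cfgGraph ω) := by
      exact_mod_cast metricDim_le_strongDim hV (cfgGraph ω)
    have h2 : (strongDim (cfgGraph ω) : ℝ) ≤ metricDim (cfgGraph ω) + 1 := by
      exact_mod_cast strongDim_le_metricDim_add_one hV (cfgGraph ω)
    simp only [hf, hg, betaR, strongDefect, Fintype.card_fin]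
    rw [abs_le]
    constructor <;> linarith
  have h1 := abs_bernExp_standardize_sub_le hp0 hp1 hfg hσ
    (by rw [← hvar, Real.sqrt_sq hσ.le]) hd hH'
  have h2 := componentAdditive_strongDefect.abs_bernExp_sub_gaussInt_le hp0 hp1 hm hσ hvar hd hH hH'
  rw [Fintype.card_fin] at h2
  have h3 : erExp n p (fun G => h (erNormβ n p G)) =
      bernExp p fun ω => h ((f ω - bernExp p f) / Real.sqrt (bernVar p f)) := by
    rw [erExp_eq_bernExp]
    simp only [erNormβ, erVar_eq_bernVar, erExp_eq_bernExp]
    simp only [hf, bernVar_sub_const, bernExp_sub, bernExp_const, sub_sub_sub_cancel_right]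
  rw [h3]
  linarith [abs_sub_le (bernExp p fun ω => h ((f ω - bernExp p f) / Real.sqrt (bernVar p f)))
    (bernExp p fun ω => h ((g ω - bernExp p g) / σ)) (gaussInt h)]

end ErdosRenyi

/-- for `G_n ∈ G(n, c/n)` with `0 < c < 1`, the distance
`d(F_n, Φ) = sup_h |∫ h dF_n − ∫ h dΦ| / (sup |h| + sup |h′|)` between the distribution
of the normalized metric dimension and the standard normal law is `O(n^{−1/2})`:
equivalently, `|E[h(W_n)] − ∫ h dΦ| ≤ C n^{−1/2} (sup |h| + sup |h′|)` for every bounded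
differentiable test function `h` with bounded derivative. -/
theorem er_metricDim_stein_rate (c : ℝ) (hc0 : 0 < c) (hc1 : c < 1) :
    ∃ C : ℝ, 0 < C ∧ ∃ N : ℕ, ∀ n : ℕ, N ≤ n →
      ∀ h : ℝ → ℝ, Differentiable ℝ h →
        (∃ M : ℝ, ∀ x : ℝ, |h x| ≤ M) → (∃ M : ℝ, ∀ x : ℝ, |deriv h x| ≤ M) →
        |erExp n (c / n) (fun G => h (erNormβ n (c / n) G)) -
            ∫ x : ℝ, h x * (Real.exp (-(x ^ 2) / 2) / Real.sqrt (2 * Real.pi))| ≤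
          C / Real.sqrt n * ((⨆ x : ℝ, |h x|) + ⨆ x : ℝ, |deriv h x|) := by

  obtain ⟨m, hm1, hm⟩ := exists_fourthMomentLE hc1
  obtain ⟨κ, hκ, N, hN⟩ := exists_mul_le_bernVar_strongDefect hc0 hc1
  have hk : 0 < Real.sqrt κ := Real.sqrt_pos.2 hκ
  have hk2 : Real.sqrt κ ^ 2 = κ := Real.sq_sqrt hκ.le
  set k := Real.sqrt κ
  set K := Real.sqrt (c * (256 * m ^ 3))
  have hK : 0 ≤ K := Real.sqrt_nonneg _
  refine ⟨4 * K / k ^ 2 + 180 * m ^ 2 / k ^ 3 + 2 / k, by positivity, max N 2,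
    fun n hn h hd hb hb' => ?_⟩
  have hn2 : 2 ≤ n := (le_max_right _ _).trans hn
  have hn0 : (0 : ℝ) < n := by exact_mod_cast (by omega : 0 < n)
  have hn1 : (1 : ℝ) ≤ n := by exact_mod_cast (by omega : 1 ≤ n)
  have hvar := hN n ((le_max_left _ _).trans hn)
  obtain ⟨M, hM⟩ := hb
  obtain ⟨M', hM'⟩ := hb'
  have hH : ∀ x, |h x| ≤ ⨆ x, |h x| :=
    le_ciSup (f := fun x => |h x|) ⟨M, Set.forall_mem_range.2 hM⟩
  have hH' : ∀ x, |deriv h x| ≤ ⨆ x, |deriv h x| :=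
    le_ciSup (f := fun x => |deriv h x|) ⟨M', Set.forall_mem_range.2 hM'⟩
  have hH0 := (abs_nonneg _).trans (hH 0)
  have hH0' := (abs_nonneg _).trans (hH' 0)
  set H := ⨆ x, |h x|
  set H' := ⨆ x, |deriv h x|
  have hp0 : 0 ≤ c / n := div_nonneg hc0.le hn0.le
  have hp1 : c / n ≤ 1 := (div_le_one hn0).2 (by linarith)
  have hpn : c / n * n = c := div_mul_cancel₀ _ hn0.ne'
  set v := bernVar (c / n) fun ω : Sym2 (Fin n) → Bool => strongDefect (cfgGraph ω)
  have hv : 0 < v := lt_of_lt_of_le (mul_pos hκ hn0) hvar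
  have hmain := abs_erExp_erNormβ_sub_gaussInt_le hn2 hp0 hp1 (hm n _ hp0 hp1 hpn.le)
    (Real.sqrt_pos.2 hv) (Real.sq_sqrt hv.le) hd hH hH'
  refine hmain.trans ?_
  set s := Real.sqrt n
  have hs : 0 < s := Real.sqrt_pos.2 hn0
  have hs2 : s ^ 2 = n := Real.sq_sqrt hn0.le
  have hσ : k * s ≤ Real.sqrt v := by
    refine Real.le_sqrt_of_sq_le ?_
    rwa [mul_pow, hk2, hs2]
  set σ := Real.sqrt v
  have hks : 0 < k * s := mul_pos hk hs
  have hroot : Real.sqrt (c / n * Fintype.card (Sym2 (Fin n)) * (256 * m ^ 3)) ≤ K * s := by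
    rw [← Real.sqrt_mul (by positivity)]
    refine Real.sqrt_le_sqrt ?_
    have h1 : c / n * Fintype.card (Sym2 (Fin n)) ≤ c * n := by
      calc c / n * Fintype.card (Sym2 (Fin n)) ≤ c / n * (n : ℝ) ^ 2 :=
            mul_le_mul_of_nonneg_left (card_sym2_le_sq n) hp0
        _ = c * n := by rw [sq, ← mul_assoc, hpn]
    calc _ ≤ c * n * (256 * m ^ 3) := mul_le_mul_of_nonneg_right h1 (by positivity)
      _ = c * (256 * m ^ 3) * n := by ring
  have t1 : 4 * H * Real.sqrt (c / n * Fintype.card (Sym2 (Fin n)) * (256 * m ^ 3)) / σ ^ 2 ≤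
      4 * K / k ^ 2 / s * (H + H') := by
    calc _ ≤ 4 * (H + H') * (K * s) / (k * s) ^ 2 := by
          refine div_le_div₀ (by positivity) ?_ (by positivity) (pow_le_pow_left₀ hks.le hσ 2)
          exact mul_le_mul (by linarith) hroot (Real.sqrt_nonneg _) (by positivity)
      _ = _ := by field_simp
  have t2 : (20 * H + 2 * H') * (n * (9 * m ^ 2)) / σ ^ 3 ≤
      180 * m ^ 2 / k ^ 3 / s * (H + H') := by
    rw [← hs2]
    calc _ ≤ (20 * (H + H')) * (s ^ 2 * (9 * m ^ 2)) / (k * s) ^ 3 := by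
          refine div_le_div₀ (by positivity) ?_ (by positivity) (pow_le_pow_left₀ hks.le hσ 3)
          exact mul_le_mul_of_nonneg_right (by linarith) (by positivity)
      _ = _ := by
        field_simp
        ring
  have t3 : H' * (2 / σ) ≤ 2 / k / s * (H + H') := by
    calc _ ≤ (H + H') * (2 / (k * s)) := by
          refine mul_le_mul (by linarith) ?_ (by positivity) (by positivity)
          exact div_le_div_of_nonneg_left (by norm_num) hks hσ
      _ = _ := by field_simp
  calc _ ≤ _ := add_le_add (add_le_add t1 t2) t3
    _ = _ := by ring

end MetricDimPaper
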